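/- arXiv:2204.12029 — 4 statements merged into one kernel-verified Lean document; each statement's English description precedes it below -/
import Mathlib

section
/- Let d ≥ 2 and s ∈ (0, d/2), and set γ_{d,s} := Γ((d+2−2s)/2)/(2^{2s} π^{d/2} Γ(1+s)). Then for every Schwartz function v : ℝ^d → ℂ and all indices 1 ≤ i, j ≤ d, both integrals below converge absolutely and γ_{d,s} ∫_{ℝ^d} |x|^{2s−d} ( x_i x_j/|x|² − δ_{ij}/(d−2s) ) v̂(x) dx = − ∫_{ℝ^d} (2π|ξ|)^{−2s} (ξ_i ξ_j/|ξ|²) v(ξ) dξ, where v̂(x) = ∫_{ℝ^d} e^{−2πi ξ·x} v(ξ) dξ. (That is, the inverse Fourier transform of the tempered distribution −(2π|ξ|)^{−2s} ξ⊗ξ/|ξ|² is γ_{d,s}|x|^{2s−d}(x⊗x/|x|² − I/(d−2s)).) -/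
open Real MeasureTheory
open scoped FourierTransform

noncomputable section

/-- `γ_{d,s} = Γ((d+2−2s)/2)/(2^{2s} π^{d/2} Γ(1+s))`. -/
def gammaConst (d : ℕ) (s : ℝ) : ℝ :=
  Real.Gamma (((d : ℝ) + 2 - 2 * s) / 2) /
    ((2 : ℝ) ^ (2 * s) * π ^ ((d : ℝ) / 2) * Real.Gamma (1 + s))

section Integrability

variable {E : Type*} [NormedAddCommGroup E] [InnerProductSpace ℝ E] [FiniteDimensional ℝ E]
  [MeasurableSpace E] [BorelSpace E]

/-- A Schwartz function is integrable against a locally integrable negative power of the norm. -/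
theorem integrable_norm_rpow_mul_schwartz [Nontrivial E] {p : ℝ}
    (hp : -(Module.finrank ℝ E : ℝ) < p) (hp0 : p ≤ 0) (f : SchwartzMap E ℂ) :
    Integrable fun x : E => ((‖x‖ ^ p : ℝ) : ℂ) * f x := by
  have hn : 1 ≤ Module.finrank ℝ E := Module.finrank_pos
  have hloc : IntegrableOn (fun x : E => ‖x‖ ^ p) (Metric.ball 0 1) := by
    rw [integrableOn_fun_norm_addHaar volume (f := fun r : ℝ => r ^ p)]
    have h : IntegrableOn (fun r : ℝ => r ^ (((Module.finrank ℝ E - 1 : ℕ) : ℝ) + p))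
        (Set.Ioo 0 1) := by
      rw [intervalIntegral.integrableOn_Ioo_rpow_iff one_pos]
      push_cast [Nat.cast_sub hn]
      linarith
    refine h.congr_fun (fun r hr => ?_) measurableSet_Ioo
    simp only [smul_eq_mul]
    rw [rpow_add hr.1, rpow_natCast]
  obtain ⟨C, -, hC⟩ := f.decay 0 0
  simp only [pow_zero, norm_iteratedFDeriv_zero, one_mul] at hC
  refine Integrable.mono' (g := fun x => C * (Metric.ball (0 : E) 1).indicator
    (fun x => ‖x‖ ^ p) x + ‖f x‖)
    (((integrable_indicator_iff measurableSet_ball).2 hloc |>.const_mul C).add f.integrable.norm)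
    ?_ (.of_forall fun x => ?_)
  · exact (Complex.measurable_ofReal.comp
      (measurable_norm.pow_const p)).aestronglyMeasurable.mul f.continuous.aestronglyMeasurable
  · have h0 : 0 ≤ ‖x‖ ^ p := by positivity
    rw [norm_mul, Complex.norm_real, Real.norm_of_nonneg h0]
    by_cases hx : x ∈ Metric.ball (0 : E) 1
    · rw [Set.indicator_of_mem hx, mul_comm]
      nlinarith [hC x, norm_nonneg (f x)]
    · rw [Set.indicator_of_notMem hx]
      have : ‖x‖ ^ p ≤ 1 := rpow_le_one_of_one_le_of_nonpos (by simpa using hx) hp0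
      nlinarith [norm_nonneg (f x)]

theorem integrable_norm_pow_mul_exp_neg_mul_sq [Nontrivial E] {b : ℝ} (hb : 0 < b) (k : ℕ) :
    Integrable fun x : E => ‖x‖ ^ k * rexp (-b * ‖x‖ ^ 2) := by
  rw [integrable_fun_norm_addHaar volume (f := fun r : ℝ => r ^ k * rexp (-b * r ^ 2))]
  refine (integrableOn_rpow_mul_exp_neg_mul_sq hb
    (s := ((Module.finrank ℝ E - 1 + k : ℕ) : ℝ)) (by
      have := Nat.cast_nonneg (α := ℝ) (Module.finrank ℝ E - 1 + k)
      linarith)).congr_fun (fun r hr => ?_) measurableSet_Ioi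
  simp only [smul_eq_mul, rpow_natCast, pow_add, mul_assoc]

end Integrability

section Gaussian

variable {E : Type*} [NormedAddCommGroup E]

/-- The Gaussian `exp(-π t ‖x‖²)`, as a complex-valued function. -/
def gaussian (t : ℝ) (x : E) : ℂ := (rexp (-(π * t) * ‖x‖ ^ 2) : ℝ)

theorem continuous_gaussian (t : ℝ) : Continuous (gaussian t : E → ℂ) := by
  unfold gaussian
  fun_prop

theorem hasFDerivAt_gaussian [InnerProductSpace ℝ E] (t : ℝ) (w : E) :
    HasFDerivAt (gaussian t : E → ℂ)
      ((-(2 * π * t) * gaussian t w : ℂ) • (Complex.ofRealCLM ∘L innerSL ℝ w)) w := by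
  have h := Complex.ofRealCLM.hasFDerivAt.comp w
    (((hasStrictFDerivAt_norm_sq w).hasFDerivAt.const_mul (-(π * t))).exp)
  refine (h.congr_fderiv ?_)
  ext m
  simp [gaussian]
  ring

end Gaussian

section Fourier

variable {E : Type*} [NormedAddCommGroup E] [InnerProductSpace ℝ E] [FiniteDimensional ℝ E]
  [MeasurableSpace E] [BorelSpace E]

/-- Multiplication by a coordinate becomes differentiation on the Fourier side. -/
theorem fourier_inner_mul_of_hasFDerivAt {f : E → ℂ} (hf : Integrable f)
    (hf' : Integrable fun x => ‖x‖ * ‖f x‖) {w : E} {L : E →L[ℝ] ℂ}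
    (hL : HasFDerivAt (𝓕 f) L w) (m : E) :
    𝓕 (fun x => ((inner ℝ x m : ℝ) : ℂ) * f x) w = Complex.I / (2 * π) * L m := by
  have hint : Integrable (VectorFourier.fourierSMulRight (innerSL ℝ) f) := by
    refine (hf'.const_mul (2 * π * ‖innerSL ℝ (E := E)‖)).mono' hf.1.fourierSMulRight
      (.of_forall fun x => ?_)
    simpa only [mul_assoc] using VectorFourier.norm_fourierSMulRight_le (innerSL ℝ) f x
  have h : (fun x => ((inner ℝ x m : ℝ) : ℂ) * f x) = (Complex.I / (2 * π)) •
      fun x => VectorFourier.fourierSMulRight (innerSL ℝ) f x m := by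
    funext x
    have hpi : (π : ℂ) ≠ 0 := by exact_mod_cast pi_ne_zero
    simp only [Pi.smul_apply, VectorFourier.fourierSMulRight_apply, smul_eq_mul, Complex.real_smul]
    field_simp
    rw [Complex.I_sq, mul_neg_one, neg_mul, neg_neg, mul_comm]
    rfl
  rw [hL.unique (hasFDerivAt_fourier hf hf' w), fourier_continuousLinearMap_apply hint, h]
  simp only [fourier_eq, Pi.smul_apply]
  rw [← smul_eq_mul (Complex.I / (2 * π) : ℂ), ← integral_smul]
  exact integral_congr_ae (.of_forall fun x => smul_comm _ _ _)

theorem integrable_norm_pow_mul_norm_gaussian [Nontrivial E] {t : ℝ} (ht : 0 < t) (k : ℕ) :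
    Integrable fun x : E => ‖x‖ ^ k * ‖(gaussian t x : ℂ)‖ := by
  simpa only [gaussian, Complex.norm_real, Real.norm_eq_abs, Real.abs_exp] using
    integrable_norm_pow_mul_exp_neg_mul_sq (E := E) (mul_pos pi_pos ht) k

theorem integrable_gaussian [Nontrivial E] {t : ℝ} (ht : 0 < t) :
    Integrable (gaussian t : E → ℂ) := by
  refine (integrable_norm_iff (continuous_gaussian t).aestronglyMeasurable).1 ?_
  simpa using integrable_norm_pow_mul_norm_gaussian (E := E) ht 0

theorem fourier_gaussian {t : ℝ} (ht : 0 < t) (w : E) :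
    𝓕 (gaussian t : E → ℂ) w =
      (t ^ (-(Module.finrank ℝ E : ℝ) / 2) : ℝ) * gaussian t⁻¹ w := by
  have hπ : (π : ℂ) ≠ 0 := by exact_mod_cast pi_ne_zero
  have h := fourier_gaussian_innerProductSpace (V := E) (b := ((π * t : ℝ) : ℂ))
    (by simpa using mul_pos pi_pos ht) w
  have h1 : (fun x : E => Complex.exp (-((π * t : ℝ) : ℂ) * (‖x‖ : ℂ) ^ 2)) = gaussian t := by
    funext x; simp [gaussian]
  rw [h1] at h
  rw [h]
  congr 1
  · rw [neg_div, Real.rpow_neg ht.le, ← Real.inv_rpow ht.le, Complex.ofReal_cpow (by positivity)]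
    push_cast
    congr 1
    field_simp
  · simp only [gaussian]
    push_cast
    congr 1
    field_simp

theorem fourier_inner_mul_gaussian [Nontrivial E] {t : ℝ} (ht : 0 < t) (m w : E) :
    𝓕 (fun x : E => ((inner ℝ x m : ℝ) : ℂ) * gaussian t x) w =
      -(Complex.I / t) * (inner ℝ w m : ℝ) *
        ((t ^ (-(Module.finrank ℝ E : ℝ) / 2) : ℝ) * gaussian t⁻¹ w) := by
  have h := (hasFDerivAt_gaussian t⁻¹ w).const_mul
    ((t ^ (-(Module.finrank ℝ E : ℝ) / 2) : ℝ) : ℂ)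
  rw [← funext (fourier_gaussian (E := E) ht)] at h
  rw [fourier_inner_mul_of_hasFDerivAt (integrable_gaussian ht)
    (by simpa using integrable_norm_pow_mul_norm_gaussian (E := E) ht 1) h]
  have hpi : (π : ℂ) ≠ 0 := by exact_mod_cast pi_ne_zero
  have ht' : (t : ℂ) ≠ 0 := by exact_mod_cast ht.ne'
  simp
  field_simp

theorem integrable_inner_mul_of_norm {f : E → ℂ} (hf : AEStronglyMeasurable f volume) {k : ℕ}
    (h : Integrable fun x => ‖x‖ ^ (k + 1) * ‖f x‖) (m : E) :
    Integrable fun x => ‖x‖ ^ k * ‖((inner ℝ x m : ℝ) : ℂ) * f x‖ := by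
  refine (h.const_mul ‖m‖).mono' (by fun_prop) (.of_forall fun x => ?_)
  simp only [norm_mul, norm_pow, norm_norm, Complex.norm_real]
  have := norm_inner_le_norm (𝕜 := ℝ) x m
  calc ‖x‖ ^ k * (‖inner ℝ x m‖ * ‖f x‖) ≤ ‖x‖ ^ k * (‖x‖ * ‖m‖ * ‖f x‖) := by gcongr
    _ = _ := by ring

theorem integrable_inner_mul_inner_mul_gaussian [Nontrivial E] {t : ℝ} (ht : 0 < t) (l m : E) :
    Integrable fun x : E =>
      ((inner ℝ x l : ℝ) : ℂ) * (((inner ℝ x m : ℝ) : ℂ) * gaussian t x) := by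
  have hmeas : AEStronglyMeasurable (gaussian t : E → ℂ) volume :=
    (continuous_gaussian t).aestronglyMeasurable
  have h1 := integrable_inner_mul_of_norm hmeas
    (integrable_norm_pow_mul_norm_gaussian (E := E) ht 2) m
  have h2 := integrable_inner_mul_of_norm (k := 0) (by fun_prop) h1 l
  simp only [pow_zero, one_mul] at h2
  exact (integrable_norm_iff (by fun_prop)).1 h2

theorem fourier_inner_mul_inner_mul_gaussian [Nontrivial E] {t : ℝ} (ht : 0 < t) (l m w : E) :
    𝓕 (fun x : E => ((inner ℝ x l : ℝ) : ℂ) * (((inner ℝ x m : ℝ) : ℂ) * gaussian t x)) w =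
      (inner ℝ l m / (2 * π * t) - inner ℝ w l * inner ℝ w m / t ^ 2 : ℝ) *
        ((t ^ (-(Module.finrank ℝ E : ℝ) / 2) : ℝ) * gaussian t⁻¹ w) := by
  have hg := (hasFDerivAt_gaussian t⁻¹ w).const_mul
    ((t ^ (-(Module.finrank ℝ E : ℝ) / 2) : ℝ) : ℂ)
  have hm : HasFDerivAt (fun w : E => ((inner ℝ w m : ℝ) : ℂ))
      (Complex.ofRealCLM ∘L innerSL ℝ m) w := by
    have := (Complex.ofRealCLM ∘L innerSL ℝ m).hasFDerivAt (x := w)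
    refine this.congr_of_eventuallyEq (.of_forall fun x => ?_)
    simp [real_inner_comm]
  have he : 𝓕 (fun x : E => ((inner ℝ x m : ℝ) : ℂ) * gaussian t x) =
      fun w => -(Complex.I / t) * (inner ℝ w m : ℝ) *
        ((t ^ (-(Module.finrank ℝ E : ℝ) / 2) : ℝ) * gaussian t⁻¹ w) :=
    funext (fourier_inner_mul_gaussian (E := E) ht m)
  have h := (hm.const_mul (-(Complex.I / t))).mul hg
  replace h := h.congr_of_eventuallyEq (.of_forall fun x => congrFun he x)
  have hmeas : AEStronglyMeasurable (gaussian t : E → ℂ) volume :=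
    (continuous_gaussian t).aestronglyMeasurable
  have hi (k : ℕ) := integrable_inner_mul_of_norm hmeas
    (integrable_norm_pow_mul_norm_gaussian (E := E) ht (k + 1)) m
  rw [fourier_inner_mul_of_hasFDerivAt
    ((integrable_norm_iff (by fun_prop)).1 (by simpa using hi 0)) (by simpa using hi 1) h]
  have hpi : (π : ℂ) ≠ 0 := by exact_mod_cast pi_ne_zero
  have ht' : (t : ℂ) ≠ 0 := by exact_mod_cast ht.ne'
  simp [real_inner_comm]
  field_simp
  ring_nf
  simp

end Fourier

section Mellin

theorem integrableOn_rpow_mul_exp_neg_mul {c r : ℝ} (hc : 0 < c) (hr : 0 < r) :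
    IntegrableOn (fun t : ℝ => t ^ (c - 1) * rexp (-(r * t))) (Set.Ioi 0) := by
  simpa using integrableOn_rpow_mul_exp_neg_mul_rpow (s := c - 1) (by linarith) one_pos hr

theorem rpow_mul_exp_neg_mul_inv_eq (c r : ℝ) {t : ℝ} (ht : 0 < t) :
    (|(-1 : ℝ)| * t ^ ((-1 : ℝ) - 1)) • ((t ^ (-1 : ℝ)) ^ (c - 1) * rexp (-(r * t ^ (-1 : ℝ)))) =
      t ^ (-c - 1) * rexp (-(r * t⁻¹)) := by
  rw [← Real.rpow_mul ht.le, abs_neg, abs_one, one_mul, smul_eq_mul, ← mul_assoc,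
    ← Real.rpow_add ht, Real.rpow_neg_one]
  ring_nf

theorem integrableOn_rpow_mul_exp_neg_mul_inv {c r : ℝ} (hc : 0 < c) (hr : 0 < r) :
    IntegrableOn (fun t : ℝ => t ^ (-c - 1) * rexp (-(r * t⁻¹))) (Set.Ioi 0) :=
  ((integrableOn_Ioi_comp_rpow_iff (fun t : ℝ => t ^ (c - 1) * rexp (-(r * t)))
    (p := -1) (by norm_num)).2 (integrableOn_rpow_mul_exp_neg_mul hc hr)).congr_fun
    (fun _ ht => rpow_mul_exp_neg_mul_inv_eq c r ht) measurableSet_Ioi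

theorem integral_rpow_mul_exp_neg_mul_inv {c r : ℝ} (hc : 0 < c) (hr : 0 < r) :
    ∫ t : ℝ in Set.Ioi 0, t ^ (-c - 1) * rexp (-(r * t⁻¹)) = (1 / r) ^ c * Real.Gamma c := by
  rw [← Real.integral_rpow_mul_exp_neg_mul_Ioi hc hr,
    ← integral_comp_rpow_Ioi (fun t : ℝ => t ^ (c - 1) * rexp (-(r * t)))
      (p := -1) (by norm_num)]
  exact setIntegral_congr_fun measurableSet_Ioi
    fun _ ht => (rpow_mul_exp_neg_mul_inv_eq c r ht).symm

theorem one_div_pi_mul_sq_rpow (c : ℝ) {r : ℝ} (hr : 0 < r) :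
    (1 / (π * r ^ 2)) ^ c = π ^ (-c) * r ^ (-(2 * c)) := by
  rw [one_div, Real.inv_rpow (by positivity), ← Real.rpow_neg (by positivity),
    Real.mul_rpow pi_pos.le (by positivity), ← Real.rpow_natCast, ← Real.rpow_mul hr.le]
  push_cast
  ring_nf

/-- Fubini for superpositions `φ = ∫ k t dt` of nonnegative kernels. -/
theorem integral_integral_kernel_mul {E : Type*} [MeasurableSpace E] {μ : Measure E} [SFinite μ]
    {k : ℝ → E → ℝ} (hk : Measurable (Function.uncurry k)) (hk0 : ∀ t ∈ Set.Ioi 0, ∀ x, 0 ≤ k t x)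
    {φ : E → ℝ} (hφ : ∀ᵐ x ∂μ, IntegrableOn (fun t => k t x) (Set.Ioi 0) ∧
      ∫ t in Set.Ioi 0, k t x = φ x)
    {f : E → ℂ} (hf : AEStronglyMeasurable f μ)
    (hφf : Integrable (fun x => (φ x : ℂ) * f x) μ) :
    IntegrableOn (fun t => ∫ x, (k t x : ℂ) * f x ∂μ) (Set.Ioi 0) ∧
      ∫ t in Set.Ioi 0, ∫ x, (k t x : ℂ) * f x ∂μ = ∫ x, (φ x : ℂ) * f x ∂μ := by
  have hint : Integrable (Function.uncurry fun t x => (k t x : ℂ) * f x)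
      ((volume.restrict (Set.Ioi 0)).prod μ) := by
    rw [integrable_prod_iff']
    · refine ⟨?_, hφf.norm.congr ?_⟩
      · filter_upwards [hφ] with x hx
        exact (hx.1.ofReal (𝕜 := ℂ)).mul_const (f x)
      · filter_upwards [hφ] with x hx
        have h0 : 0 ≤ φ x := hx.2 ▸ setIntegral_nonneg measurableSet_Ioi fun t ht => hk0 t ht x
        simp only [Function.uncurry, norm_mul, Complex.norm_real]
        rw [integral_mul_const, Real.norm_of_nonneg h0, ← hx.2]
        congr 1
        exact setIntegral_congr_fun measurableSet_Ioi
          fun t ht => (Real.norm_of_nonneg (hk0 t ht x)).symm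
    · exact (Complex.measurable_ofReal.comp hk).aestronglyMeasurable.mul hf.comp_snd
  refine ⟨hint.integral_prod_left, ?_⟩
  rw [integral_integral_swap hint]
  refine integral_congr_ae ?_
  filter_upwards [hφ] with x hx
  have h : ∫ t in Set.Ioi (0 : ℝ), (k t x : ℂ) * f x =
      (∫ t in Set.Ioi (0 : ℝ), (k t x : ℂ)) * f x := integral_mul_const _ _
  rw [h, integral_complex_ofReal, hx.2]

end Mellin

section Main

variable {E : Type*} [NormedAddCommGroup E] [InnerProductSpace ℝ E] [FiniteDimensional ℝ E]
  [MeasurableSpace E] [BorelSpace E]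

theorem integral_fourier_mul_eq_of_integrable {f g : E → ℂ} (hf : Integrable f)
    (hg : Integrable g) : ∫ x, 𝓕 f x * g x = ∫ x, f x * 𝓕 g x := by
  have h := VectorFourier.integral_fourierIntegral_smul_eq_flip (μ := volume) (ν := volume)
    (L := innerₗ E) continuous_fourierChar continuous_inner hf hg
  rw [flip_innerₗ] at h
  exact h

theorem integral_fourier_gaussian_mul [Nontrivial E] {t : ℝ} (ht : 0 < t) (l m : E)
    (v : SchwartzMap E ℂ) :
    ∫ x : E, gaussian t x * (((inner ℝ x l * inner ℝ x m : ℝ) : ℂ) * 𝓕 (v : E → ℂ) x) =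
      (inner ℝ l m / (2 * π * t) : ℝ) * (∫ x : E, gaussian t x * 𝓕 (v : E → ℂ) x) -
      (t ^ (-(Module.finrank ℝ E : ℝ) / 2 - 2) : ℝ) *
        ∫ w : E, gaussian t⁻¹ w * (((inner ℝ w l * inner ℝ w m : ℝ) : ℂ) * v w) := by
  have h3 := integral_fourier_mul_eq_of_integrable
    (integrable_inner_mul_inner_mul_gaussian ht l m) v.integrable
  have h4 := integral_fourier_mul_eq_of_integrable (integrable_gaussian (E := E) ht) v.integrable
  have hpoly (u : ℝ) (hu : 0 < u) : Integrable fun w : E =>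
      gaussian u w * (((inner ℝ w l * inner ℝ w m : ℝ) : ℂ) * v w) := by
    obtain ⟨C, -, hC⟩ := v.decay 0 0
    simp only [pow_zero, norm_iteratedFDeriv_zero, one_mul] at hC
    refine ((integrable_inner_mul_inner_mul_gaussian hu l m).mul_bdd
      (c := C) v.continuous.aestronglyMeasurable (.of_forall hC)).congr (.of_forall fun w => ?_)
    push_cast
    ring
  have hv : Integrable fun w : E => 𝓕 (gaussian t : E → ℂ) w * v w := by
    obtain ⟨C, -, hC⟩ := v.decay 0 0
    simp only [pow_zero, norm_iteratedFDeriv_zero, one_mul] at hC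
    simp only [fourier_gaussian ht]
    exact ((integrable_gaussian (inv_pos.2 ht)).const_mul _).mul_bdd
      (c := C) v.continuous.aestronglyMeasurable (.of_forall hC)
  rw [← h4, ← integral_const_mul, ← integral_const_mul,
    ← integral_sub (hv.const_mul _) ((hpoly _ (inv_pos.2 ht)).const_mul _)]
  calc _ = _ := integral_congr_ae (.of_forall fun x => by push_cast; ring)
    _ = _ := h3.symm
    _ = _ := integral_congr_ae (.of_forall fun w => ?_)
  simp only []
  rw [fourier_inner_mul_inner_mul_gaussian ht, fourier_gaussian ht, Real.rpow_sub ht]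
  push_cast
  rw [Real.rpow_two]
  push_cast
  ring

theorem integrable_norm_rpow_mul_inner_mul_inner [Nontrivial E] {p : ℝ}
    (hp : -(Module.finrank ℝ E : ℝ) < p) (hp0 : p ≤ 0) (l m : E) (f : SchwartzMap E ℂ) :
    Integrable fun x : E =>
      ((‖x‖ ^ (p - 2) : ℝ) : ℂ) * (((inner ℝ x l * inner ℝ x m : ℝ) : ℂ) * f x) := by
  refine ((integrable_norm_rpow_mul_schwartz hp hp0 f).norm.const_mul (‖l‖ * ‖m‖)).mono'
    ?_ ?_
  · exact (Complex.measurable_ofReal.comp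
      (measurable_norm.pow_const _)).aestronglyMeasurable.mul (by fun_prop)
  · filter_upwards [Measure.ae_ne volume (0 : E)] with x hx
    have hx' : 0 < ‖x‖ := norm_pos_iff.2 hx
    have h1 := norm_inner_le_norm (𝕜 := ℝ) x l
    have h2 := norm_inner_le_norm (𝕜 := ℝ) x m
    simp only [norm_mul, Complex.norm_real]
    rw [Real.norm_of_nonneg (Real.rpow_nonneg hx'.le _),
      Real.norm_of_nonneg (Real.rpow_nonneg hx'.le _), Real.rpow_sub hx', Real.rpow_two]
    calc ‖x‖ ^ p / ‖x‖ ^ 2 * (‖inner ℝ x l‖ * ‖inner ℝ x m‖ * ‖f x‖)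
        ≤ ‖x‖ ^ p / ‖x‖ ^ 2 * (‖x‖ * ‖l‖ * (‖x‖ * ‖m‖) * ‖f x‖) := by gcongr
      _ = _ := by field_simp

/-- The Fourier transform of a second-order Riesz kernel, tested against a Schwartz function. -/
theorem integral_norm_rpow_mul_inner_mul_inner_fourier [Nontrivial E] {b s : ℝ} (hb : 0 < b)
    (hs : 0 < s) (hbs : b + s = Module.finrank ℝ E / 2) (l m : E) (v : SchwartzMap E ℂ) :
    (π ^ (-(b + 1)) * Real.Gamma (b + 1) : ℝ) * (∫ x : E, ((‖x‖ ^ (-(2 * b) - 2) : ℝ) : ℂ) *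
        (((inner ℝ x l * inner ℝ x m : ℝ) : ℂ) * 𝓕 (v : E → ℂ) x)) =
      (inner ℝ l m / (2 * π) * (π ^ (-b) * Real.Gamma b) : ℝ) *
        (∫ x : E, ((‖x‖ ^ (-(2 * b)) : ℝ) : ℂ) * 𝓕 (v : E → ℂ) x) -
      (π ^ (-(s + 1)) * Real.Gamma (s + 1) : ℝ) * ∫ w : E, ((‖w‖ ^ (-(2 * s) - 2) : ℝ) : ℂ) *
        (((inner ℝ w l * inner ℝ w m : ℝ) : ℂ) * v w) := by
  have hgm : Measurable fun q : ℝ × E => rexp (-(π * q.1) * ‖q.2‖ ^ 2) := by fun_prop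
  have hgm' : Measurable fun q : ℝ × E => rexp (-(π * q.1⁻¹) * ‖q.2‖ ^ 2) := by fun_prop
  have hker (c : ℝ) (hc : 0 < c) : ∀ᵐ x : E,
      IntegrableOn (fun t : ℝ => t ^ (c - 1) * rexp (-(π * t) * ‖x‖ ^ 2)) (Set.Ioi 0) ∧
      ∫ t in Set.Ioi 0, t ^ (c - 1) * rexp (-(π * t) * ‖x‖ ^ 2) =
        π ^ (-c) * Real.Gamma c * ‖x‖ ^ (-(2 * c)) := by
    filter_upwards [Measure.ae_ne volume (0 : E)] with x hx
    have hx' : 0 < ‖x‖ := norm_pos_iff.2 hx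
    have hr : 0 < π * ‖x‖ ^ 2 := by positivity
    have he (t : ℝ) : -(π * t) * ‖x‖ ^ 2 = -(π * ‖x‖ ^ 2 * t) := by ring
    simp only [he]
    refine ⟨integrableOn_rpow_mul_exp_neg_mul hc hr, ?_⟩
    rw [Real.integral_rpow_mul_exp_neg_mul_Ioi hc hr, one_div_pi_mul_sq_rpow c hx']
    ring
  have hker' (c : ℝ) (hc : 0 < c) : ∀ᵐ x : E,
      IntegrableOn (fun t : ℝ => t ^ (-c - 1) * rexp (-(π * t⁻¹) * ‖x‖ ^ 2)) (Set.Ioi 0) ∧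
      ∫ t in Set.Ioi 0, t ^ (-c - 1) * rexp (-(π * t⁻¹) * ‖x‖ ^ 2) =
        π ^ (-c) * Real.Gamma c * ‖x‖ ^ (-(2 * c)) := by
    filter_upwards [Measure.ae_ne volume (0 : E)] with x hx
    have hx' : 0 < ‖x‖ := norm_pos_iff.2 hx
    have hr : 0 < π * ‖x‖ ^ 2 := by positivity
    have he (t : ℝ) : -(π * t⁻¹) * ‖x‖ ^ 2 = -(π * ‖x‖ ^ 2 * t⁻¹) := by ring
    simp only [he]
    refine ⟨integrableOn_rpow_mul_exp_neg_mul_inv hc hr, ?_⟩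
    rw [integral_rpow_mul_exp_neg_mul_inv hc hr, one_div_pi_mul_sq_rpow c hx']
    ring
  have hcv : Continuous (𝓕 (v : E → ℂ)) := (𝓕 v).continuous
  have hnn (c u t : ℝ) (ht : t ∈ Set.Ioi (0 : ℝ)) : 0 ≤ t ^ c * rexp u :=
    mul_nonneg (Real.rpow_nonneg (le_of_lt ht) _) (Real.exp_nonneg _)
  have hexp (c : ℝ) : -(2 * (c + 1)) = -(2 * c) - 2 := by ring
  have i1 := integrable_norm_rpow_mul_schwartz (p := -(2 * b)) (by linarith) (by linarith) (𝓕 v)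
  have i2 := integrable_norm_rpow_mul_inner_mul_inner (p := -(2 * b)) (by linarith) (by linarith)
    l m (𝓕 v)
  have i3 := integrable_norm_rpow_mul_inner_mul_inner (p := -(2 * s)) (by linarith) (by linarith)
    l m v
  rw [SchwartzMap.fourier_coe] at i1 i2
  obtain ⟨j1, e1⟩ := integral_integral_kernel_mul (μ := volume)
    (k := fun t (x : E) => t ^ (b - 1) * rexp (-(π * t) * ‖x‖ ^ 2))
    ((measurable_fst.pow_const _).mul hgm) (fun t ht x => hnn _ _ t ht) (hker b hb)
    (f := 𝓕 (v : E → ℂ)) (by fun_prop)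
    ((i1.const_mul _).congr (.of_forall fun x => by push_cast; exact (mul_assoc _ _ _).symm))
  obtain ⟨j2, e2⟩ := integral_integral_kernel_mul (μ := volume)
    (k := fun t (x : E) => t ^ (b + 1 - 1) * rexp (-(π * t) * ‖x‖ ^ 2))
    ((measurable_fst.pow_const _).mul hgm) (fun t ht x => hnn _ _ t ht)
    (hker (b + 1) (by linarith))
    (f := fun x => ((inner ℝ x l * inner ℝ x m : ℝ) : ℂ) * 𝓕 (v : E → ℂ) x) (by fun_prop)
    ((i2.const_mul _).congr (.of_forall fun x => by
      rw [hexp]; push_cast; exact (mul_assoc _ _ _).symm))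
  obtain ⟨j3, e3⟩ := integral_integral_kernel_mul (μ := volume)
    (k := fun t (x : E) => t ^ (-(s + 1) - 1) * rexp (-(π * t⁻¹) * ‖x‖ ^ 2))
    ((measurable_fst.pow_const _).mul hgm') (fun t ht x => hnn _ _ t ht)
    (hker' (s + 1) (by linarith))
    (f := fun x => ((inner ℝ x l * inner ℝ x m : ℝ) : ℂ) * v x) (by fun_prop)
    ((i3.const_mul _).congr (.of_forall fun x => by
      rw [hexp]; push_cast; exact (mul_assoc _ _ _).symm))
  have pull (C : ℝ) (g : E → ℝ) (F : E → ℂ) :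
      ∫ x, ((C * g x : ℝ) : ℂ) * F x = (C : ℂ) * ∫ x, (g x : ℂ) * F x := by
    rw [← integral_const_mul]
    exact integral_congr_ae (.of_forall fun x => by push_cast; ring)
  simp only [hexp] at e2 e3
  rw [pull (π ^ (-b) * Real.Gamma b)] at e1
  rw [pull (π ^ (-(b + 1)) * Real.Gamma (b + 1))] at e2
  rw [pull (π ^ (-(s + 1)) * Real.Gamma (s + 1))] at e3
  rw [← e2, ← e3, Complex.ofReal_mul (_ / _), mul_assoc, ← e1, ← integral_const_mul,
    ← integral_sub (j1.const_mul _) j3]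
  refine setIntegral_congr_fun measurableSet_Ioi fun t (ht : 0 < t) => ?_
  have h := integral_fourier_gaussian_mul ht l m v
  rw [pull (t ^ (b + 1 - 1)), pull (t ^ (b - 1)), pull (t ^ (-(s + 1) - 1))]
  simp only [gaussian] at h
  rw [add_sub_cancel_right, h, mul_sub, show -(s + 1) - 1 = b + (-(Module.finrank ℝ E : ℝ) / 2 - 2)
    by linarith, Real.rpow_add ht, Real.rpow_sub_one ht.ne']
  push_cast
  ring

end Main

/-- The inverse Fourier transform of `−(2π|ξ|)^{−2s} ξ⊗ξ/|ξ|²` is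
`γ_{d,s}|x|^{2s−d}(x⊗x/|x|² − I/(d−2s))`, entrywise, tested against Schwartz functions:
both pairings converge absolutely and agree. -/
theorem inv_fourier_riesz_second_order (d : ℕ) (hd : 2 ≤ d) (s : ℝ)
    (hs : s ∈ Set.Ioo 0 ((d : ℝ) / 2))
    (v : SchwartzMap (EuclideanSpace ℝ (Fin d)) ℂ) (i j : Fin d) :
    Integrable (fun x : EuclideanSpace ℝ (Fin d) =>
      (((‖x‖ ^ (2 * s - (d : ℝ)) *
          (x i * x j / ‖x‖ ^ 2 - (if i = j then (1 : ℝ) else 0) / ((d : ℝ) - 2 * s))) : ℝ) : ℂ) *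
        𝓕 (v : EuclideanSpace ℝ (Fin d) → ℂ) x) ∧
    Integrable (fun ξ : EuclideanSpace ℝ (Fin d) =>
      (((2 * π * ‖ξ‖) ^ (-(2 * s)) * (ξ i * ξ j / ‖ξ‖ ^ 2) : ℝ) : ℂ) * v ξ) ∧
    (gammaConst d s : ℂ) *
        (∫ x : EuclideanSpace ℝ (Fin d),
          (((‖x‖ ^ (2 * s - (d : ℝ)) *
              (x i * x j / ‖x‖ ^ 2 -
                (if i = j then (1 : ℝ) else 0) / ((d : ℝ) - 2 * s))) : ℝ) : ℂ) *
            𝓕 (v : EuclideanSpace ℝ (Fin d) → ℂ) x) =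
      -∫ ξ : EuclideanSpace ℝ (Fin d),
        (((2 * π * ‖ξ‖) ^ (-(2 * s)) * (ξ i * ξ j / ‖ξ‖ ^ 2) : ℝ) : ℂ) * v ξ := by
  have : Nontrivial (EuclideanSpace ℝ (Fin d)) :=
    Module.nontrivial_of_finrank_pos (R := ℝ) (by rw [finrank_euclideanSpace_fin]; omega)
  obtain ⟨hs0, hsd⟩ := hs
  set b : ℝ := d / 2 - s with hb_def
  have hb : 0 < b := by linarith
  have hfin : Module.finrank ℝ (EuclideanSpace ℝ (Fin d)) = d := finrank_euclideanSpace_fin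
  set l : EuclideanSpace ℝ (Fin d) := EuclideanSpace.single i 1 with hl
  set m : EuclideanSpace ℝ (Fin d) := EuclideanSpace.single j 1 with hm
  have hxl (x : EuclideanSpace ℝ (Fin d)) : inner ℝ x l = x i := by
    simp [hl, EuclideanSpace.inner_single_right]
  have hxm (x : EuclideanSpace ℝ (Fin d)) : inner ℝ x m = x j := by
    simp [hm, EuclideanSpace.inner_single_right]
  have hlm : inner ℝ l m = if i = j then (1 : ℝ) else 0 := by
    rw [hxm, hl, PiLp.single_apply]
    simp only [eq_comm]
  have hp : (2 * s - (d : ℝ)) = -(2 * b) := by rw [hb_def]; ring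
  have hd2 : (d : ℝ) - 2 * s = 2 * b := by rw [hb_def]; ring
  have i1 := integrable_norm_rpow_mul_schwartz (p := -(2 * b)) (by rw [hfin]; linarith)
    (by linarith) (𝓕 v)
  have i2 := integrable_norm_rpow_mul_inner_mul_inner (p := -(2 * b)) (by rw [hfin]; linarith)
    (by linarith) l m (𝓕 v)
  have i3 := integrable_norm_rpow_mul_inner_mul_inner (p := -(2 * s)) (by rw [hfin]; linarith)
    (by linarith) l m v
  rw [SchwartzMap.fourier_coe] at i1 i2
  have key := integral_norm_rpow_mul_inner_mul_inner_fourier hb hs0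
    (by rw [hfin, hb_def]; ring) l m v
  rw [hlm] at key
  rw [hp, hd2]
  set δ : ℝ := if i = j then (1 : ℝ) else 0
  simp only [hxl, hxm] at i2 i3 key
  have c1 : (fun x : EuclideanSpace ℝ (Fin d) =>
      ((‖x‖ ^ (-(2 * b) - 2) : ℝ) : ℂ) * (((x i * x j : ℝ) : ℂ) * 𝓕 (v : _ → ℂ) x) -
        ((δ / (2 * b) : ℝ) : ℂ) * (((‖x‖ ^ (-(2 * b)) : ℝ) : ℂ) * 𝓕 (v : _ → ℂ) x)) =ᵐ[volume]
      fun x => ((‖x‖ ^ (-(2 * b)) * (x i * x j / ‖x‖ ^ 2 - δ / (2 * b)) : ℝ) : ℂ) *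
        𝓕 (v : _ → ℂ) x := by
    filter_upwards [Measure.ae_ne volume (0 : EuclideanSpace ℝ (Fin d))] with x hx
    rw [Real.rpow_sub (norm_pos_iff.2 hx), Real.rpow_two]
    push_cast
    ring
  have c2 : (fun x : EuclideanSpace ℝ (Fin d) => (((2 * π) ^ (-(2 * s)) : ℝ) : ℂ) *
      (((‖x‖ ^ (-(2 * s) - 2) : ℝ) : ℂ) * (((x i * x j : ℝ) : ℂ) * v x))) =ᵐ[volume]
      fun x => (((2 * π * ‖x‖) ^ (-(2 * s)) * (x i * x j / ‖x‖ ^ 2) : ℝ) : ℂ) * v x := by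
    filter_upwards [Measure.ae_ne volume (0 : EuclideanSpace ℝ (Fin d))] with x hx
    rw [Real.rpow_sub (norm_pos_iff.2 hx), Real.rpow_two,
      Real.mul_rpow (by positivity) (norm_nonneg x)]
    push_cast
    ring
  refine ⟨(i2.sub (i1.const_mul _)).congr c1, (i3.const_mul _).congr c2, ?_⟩
  rw [← integral_congr_ae c1, ← integral_congr_ae c2, integral_sub i2 (i1.const_mul _),
    integral_const_mul, integral_const_mul]
  have hΓs : 0 < Real.Gamma (s + 1) := Real.Gamma_pos_of_pos (by linarith)
  have hγ : gammaConst d s = (2 * π) ^ (-(2 * s)) * (π ^ (-(b + 1)) * Real.Gamma (b + 1)) /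
      (π ^ (-(s + 1)) * Real.Gamma (s + 1)) := by
    have h1 : ((d : ℝ) + 2 - 2 * s) / 2 = b + 1 := by rw [hb_def]; ring
    have h2 : π ^ (-(s + 1)) = π ^ (-(2 * s)) * π ^ (-(b + 1)) * π ^ ((d : ℝ) / 2) := by
      rw [← Real.rpow_add pi_pos, ← Real.rpow_add pi_pos, hb_def]
      ring_nf
    rw [gammaConst, h1, h2, Real.mul_rpow two_pos.le pi_pos.le, Real.rpow_neg two_pos.le,
      add_comm 1 s]
    have := Real.rpow_pos_of_pos pi_pos (-(2 * s))
    have := Real.rpow_pos_of_pos pi_pos (-(b + 1))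
    field_simp
  have hδ : δ / (2 * π) * (π ^ (-b) * Real.Gamma b) =
      π ^ (-(b + 1)) * Real.Gamma (b + 1) * (δ / (2 * b)) := by
    rw [Real.Gamma_add_one hb.ne', neg_add, ← sub_eq_add_neg, Real.rpow_sub_one pi_ne_zero]
    field_simp
  have hne : ((π ^ (-(s + 1)) * Real.Gamma (s + 1) : ℝ) : ℂ) ≠ 0 := by
    exact_mod_cast (mul_pos (Real.rpow_pos_of_pos pi_pos _) hΓs).ne'
  rw [hδ] at key
  rw [hγ]
  generalize π ^ (-(b + 1)) * Real.Gamma (b + 1) = P at key ⊢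
  generalize π ^ (-(s + 1)) * Real.Gamma (s + 1) = Q at key hne ⊢
  rw [Complex.ofReal_div, Complex.ofReal_mul _ P]
  rw [Complex.ofReal_mul P] at key
  rw [div_mul_eq_mul_div, div_eq_iff hne]
  linear_combination (((2 * π) ^ (-(2 * s)) : ℝ) : ℂ) * key
end
end

section
/- Let d ≥ 2, s ∈ (0,1), μ > 0, 2μ + λ > 0, and let u : ℝ^d → ℝ^d be a Schwartz vector field. Then there exists a constant C, depending only on d, s, μ, λ and u, such that |𝕃^s u(x)| ≤ C |x|^{−d−2s} for every x ∈ ℝ^d with |x| ≥ 1. -/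
open Real MeasureTheory
open scoped RealInnerProductSpace

noncomputable section

/-- `c_{d,s} = 2^{2s} s Γ(d/2+s)/(π^{d/2} Γ(1−s))`. -/
def cConst (d : ℕ) (s : ℝ) : ℝ :=
  (2 : ℝ) ^ (2 * s) * s * Real.Gamma ((d : ℝ) / 2 + s) /
    (π ^ ((d : ℝ) / 2) * Real.Gamma (1 - s))

/-- `κ_{d,s} = (d+2s) c_{d,s}`. -/
def kappaConst (d : ℕ) (s : ℝ) : ℝ := ((d : ℝ) + 2 * s) * cConst d s

/-- The fractional Lamé–Navier operator `𝕃^s u` in second-order-difference form. -/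
def lameFrac (d : ℕ) (s μ lam : ℝ)
    (u : SchwartzMap (EuclideanSpace ℝ (Fin d)) (EuclideanSpace ℝ (Fin d)))
    (x : EuclideanSpace ℝ (Fin d)) : EuclideanSpace ℝ (Fin d) :=
  (((2 * s + 1) * μ ^ s - (2 * μ + lam) ^ s) / (2 * s) * (cConst d s / 2)) •
      (∫ h : EuclideanSpace ℝ (Fin d),
        (‖h‖ ^ ((d : ℝ) + 2 * s))⁻¹ • ((2 : ℝ) • u x - u (x + h) - u (x - h))) +
    (((2 * μ + lam) ^ s - μ ^ s) / (2 * s) * (kappaConst d s / 2)) •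
      (∫ h : EuclideanSpace ℝ (Fin d),
        (⟪h, (2 : ℝ) • u x - u (x + h) - u (x - h)⟫ /
          (‖h‖ ^ 2 * ‖h‖ ^ ((d : ℝ) + 2 * s))) • h)

/-- A Schwartz map is uniformly `O(‖x‖ ^ (-p))` on `{y | ‖x‖ / 2 ≤ ‖y‖}`, for `‖x‖ ≥ 1`. -/
lemma SchwartzMap.exists_norm_le_rpow_of_half_norm_le {E F : Type*} [NormedAddCommGroup E]
    [NormedSpace ℝ E] [NormedAddCommGroup F] [NormedSpace ℝ F] (f : SchwartzMap E F) (p : ℝ) :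
    ∃ C : ℝ, 0 ≤ C ∧ ∀ x y : E, 1 ≤ ‖x‖ → ‖x‖ / 2 ≤ ‖y‖ → ‖f y‖ ≤ C * ‖x‖ ^ (-p) := by
  obtain ⟨C, hC, hf⟩ := f.decay ⌈p⌉₊ 0
  refine ⟨2 ^ ⌈p⌉₊ * C, by positivity, fun x y hx hxy => ?_⟩
  have hx0 : 0 < ‖x‖ := by linarith
  have hy := hf y
  rw [norm_iteratedFDeriv_zero] at hy
  rw [Real.rpow_neg hx0.le, ← div_eq_mul_inv, le_div_iff₀ (by positivity)]
  calc ‖f y‖ * ‖x‖ ^ p ≤ ‖f y‖ * ‖x‖ ^ ⌈p⌉₊ := by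
        gcongr
        rw [← Real.rpow_natCast]
        exact Real.rpow_le_rpow_of_exponent_le hx (Nat.le_ceil p)
    _ = 2 ^ ⌈p⌉₊ * ((‖x‖ / 2) ^ ⌈p⌉₊ * ‖f y‖) := by
        rw [div_pow]; field_simp
    _ ≤ 2 ^ ⌈p⌉₊ * (‖y‖ ^ ⌈p⌉₊ * ‖f y‖) := by gcongr
    _ ≤ 2 ^ ⌈p⌉₊ * C := by gcongr

/-- Second-order mean value inequality for symmetric differences. -/
lemma norm_symm_second_diff_le {E F : Type*} [NormedAddCommGroup E]
    [NormedSpace ℝ E] [NormedAddCommGroup F] [NormedSpace ℝ F] {f : E → F}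
    (hf : Differentiable ℝ f) (hf' : Differentiable ℝ (fderiv ℝ f)) {x h : E} {M : ℝ}
    (hM : ∀ z ∈ Metric.closedBall x ‖h‖, ‖fderiv ℝ (fderiv ℝ f) z‖ ≤ M) :
    ‖(2 : ℝ) • f x - f (x + h) - f (x - h)‖ ≤ 2 * M * ‖h‖ ^ 2 := by
  have hM0 : 0 ≤ M := (norm_nonneg (fderiv ℝ (fderiv ℝ f) x)).trans
    (hM x (Metric.mem_closedBall_self (norm_nonneg h)))
  have hderiv : ∀ k : E, HasFDerivAt (fun k => f (x + k) + f (x - k))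
      (fderiv ℝ f (x + k) - fderiv ℝ f (x - k)) k := fun k => by
    have h1 : HasFDerivAt (fun k => f (x + k)) (fderiv ℝ f (x + k)) k := by
      simpa [Function.comp_def] using
        (hf (x + k)).hasFDerivAt.comp k ((hasFDerivAt_id k).const_add x)
    have h2 : HasFDerivAt (fun k => f (x - k)) (-fderiv ℝ f (x - k)) k := by
      simpa [Function.comp_def] using
        (hf (x - k)).hasFDerivAt.comp k ((hasFDerivAt_id k).const_sub x)
    rw [sub_eq_add_neg]
    exact h1.add h2
  have hbound : ∀ k ∈ Metric.closedBall (0 : E) ‖h‖,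
      ‖fderiv ℝ f (x + k) - fderiv ℝ f (x - k)‖ ≤ 2 * M * ‖h‖ := fun k hk => by
    rw [mem_closedBall_zero_iff] at hk
    have := (convex_closedBall x ‖h‖).norm_image_sub_le_of_norm_fderiv_le (𝕜 := ℝ)
      (fun z _ => hf' z) hM (x := x - k) (y := x + k) (by simpa [dist_eq_norm] using hk)
      (by simpa [dist_eq_norm] using hk)
    calc _ ≤ _ := this
      _ = M * ‖(2 : ℝ) • k‖ := by rw [two_smul]; congr 2; abel
      _ ≤ 2 * M * ‖h‖ := by
        rw [norm_smul, Real.norm_ofNat]; nlinarith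
  have := (convex_closedBall (0 : E) ‖h‖).norm_image_sub_le_of_norm_hasFDerivWithin_le (𝕜 := ℝ)
    (fun k _ => (hderiv k).hasFDerivWithinAt) hbound
    (Metric.mem_closedBall_self (norm_nonneg h)) (show h ∈ _ by simp)
  rw [← norm_neg]
  calc _ = _ := by congr 1; rw [two_smul]; simp only [add_zero, sub_zero]; abel
    _ ≤ _ := this
    _ = _ := by rw [sub_zero]; ring

/-- `‖h‖ ^ (2 - p)` near the origin and `‖h‖ ^ (-p)` away from it, as a function of `‖h‖`. -/
def levyKernel (p r : ℝ) : ℝ := if r ≤ 1 / 2 then r ^ (2 - p) else r ^ (-p)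

lemma levyKernel_nonneg (p : ℝ) {r : ℝ} (hr : 0 ≤ r) : 0 ≤ levyKernel p r := by
  unfold levyKernel
  split_ifs <;> positivity

lemma integrable_levyKernel_norm {E : Type*} [NormedAddCommGroup E] [NormedSpace ℝ E]
    [FiniteDimensional ℝ E] [Nontrivial E] [MeasurableSpace E] [BorelSpace E] (ν : Measure E)
    [ν.IsAddHaarMeasure] {p : ℝ} (hp : Module.finrank ℝ E < p) (hp' : p < Module.finrank ℝ E + 2) :
    Integrable (fun h : E => levyKernel p ‖h‖) ν := by
  rw [integrable_fun_norm_addHaar ν (f := levyKernel p)]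
  have hdim : ((Module.finrank ℝ E - 1 : ℕ) : ℝ) = Module.finrank ℝ E - 1 := by
    rw [Nat.cast_sub Module.finrank_pos, Nat.cast_one]
  have hmul : ∀ (y a : ℝ), 0 < y → y ^ (Module.finrank ℝ E - 1) * y ^ a =
      y ^ ((Module.finrank ℝ E : ℝ) - 1 + a) := fun y a hy => by
    rw [← Real.rpow_natCast, ← Real.rpow_add hy, hdim]
  rw [← Set.Ioc_union_Ioi_eq_Ioi (show (0 : ℝ) ≤ 1 / 2 by norm_num)]
  refine IntegrableOn.union ?_ ?_
  · have : IntegrableOn (fun y : ℝ => y ^ ((Module.finrank ℝ E : ℝ) - 1 + (2 - p)))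
        (Set.Ioc 0 (1 / 2)) := by
      rw [integrableOn_Ioc_iff_integrableOn_Ioo,
        intervalIntegral.integrableOn_Ioo_rpow_iff (by norm_num)]
      linarith
    refine this.congr_fun (fun y hy => ?_) measurableSet_Ioc
    simp only [levyKernel, if_pos hy.2, smul_eq_mul, hmul y _ hy.1]
  · have : IntegrableOn (fun y : ℝ => y ^ ((Module.finrank ℝ E : ℝ) - 1 + (-p)))
        (Set.Ioi (1 / 2)) :=
      integrableOn_Ioi_rpow_of_lt (by linarith) (by norm_num)
    refine this.congr_fun (fun y hy => ?_) measurableSet_Ioi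
    have hy' : 1 / 2 < y := hy
    simp only [levyKernel, if_neg (not_le.mpr hy'), smul_eq_mul, hmul y _ (by linarith)]

/-- Pointwise bound for the singular second-order difference quotient of a Schwartz map. -/
lemma SchwartzMap.exists_kernel_second_diff_le {E F : Type*} [NormedAddCommGroup E]
    [NormedSpace ℝ E] [NormedAddCommGroup F] [NormedSpace ℝ F] (f : SchwartzMap E F) {p : ℝ}
    (hp : 0 < p) :
    ∃ C : ℝ, ∀ x h : E, 1 ≤ ‖x‖ →
      (‖h‖ ^ p)⁻¹ * ‖(2 : ℝ) • f x - f (x + h) - f (x - h)‖ ≤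
        (C * levyKernel p ‖h‖ + 2 ^ p * (‖f (x + h)‖ + ‖f (x - h)‖)) * ‖x‖ ^ (-p) := by
  obtain ⟨C, hC, hf⟩ := f.exists_norm_le_rpow_of_half_norm_le p
  obtain ⟨C₂, hC₂, hf₂⟩ := (fderivCLM ℝ E (E →L[ℝ] F)
    (fderivCLM ℝ E F f)).exists_norm_le_rpow_of_half_norm_le p
  have hcoe : (fderivCLM ℝ E F f : E → E →L[ℝ] F) = fderiv ℝ f := rfl
  have hdf : Differentiable ℝ (fderiv ℝ f) := hcoe ▸ (fderivCLM ℝ E F f).differentiable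
  refine ⟨2 * C₂ + 4 * C, fun x h hx => ?_⟩
  have hx0 : 0 < ‖x‖ := by linarith
  have hA : 0 < ‖x‖ ^ (-p) := by positivity
  rcases le_or_gt ‖h‖ (1 / 2) with hh | hh
  · have hdiff := norm_symm_second_diff_le f.differentiable hdf (x := x) (h := h)
      (M := C₂ * ‖x‖ ^ (-p)) (fun z hz => by
        have := hf₂ x z hx (by
          rw [mem_closedBall_iff_norm'] at hz
          have := norm_sub_norm_le x z
          linarith)
        simpa only [fderivCLM_apply, hcoe] using this)
    have hker : (‖h‖ ^ p)⁻¹ * ‖h‖ ^ 2 ≤ levyKernel p ‖h‖ := by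
      rcases (norm_nonneg h).eq_or_lt with h0 | h0
      · rw [← h0]
        simpa using levyKernel_nonneg p le_rfl
      · rw [levyKernel, if_pos hh, Real.rpow_sub h0, Real.rpow_two, div_eq_inv_mul]
    have hk := levyKernel_nonneg p (norm_nonneg h)
    calc _ ≤ (‖h‖ ^ p)⁻¹ * (2 * (C₂ * ‖x‖ ^ (-p)) * ‖h‖ ^ 2) := by gcongr
      _ = 2 * C₂ * ((‖h‖ ^ p)⁻¹ * ‖h‖ ^ 2) * ‖x‖ ^ (-p) := by ring
      _ ≤ 2 * C₂ * levyKernel p ‖h‖ * ‖x‖ ^ (-p) := by gcongr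
      _ ≤ _ := by
        gcongr
        have h1 : 0 ≤ 4 * C * levyKernel p ‖h‖ := by positivity
        have h2 : 0 ≤ 2 ^ p * (‖f (x + h)‖ + ‖f (x - h)‖) := by positivity
        linarith
  · have h0 : 0 < ‖h‖ := by linarith
    have hker : levyKernel p ‖h‖ = (‖h‖ ^ p)⁻¹ := by
      rw [levyKernel, if_neg (not_le.mpr hh), Real.rpow_neg h0.le]
    have hk : 0 < (‖h‖ ^ p)⁻¹ := by positivity
    have key : ∀ y : E, ‖x‖ ≤ ‖h‖ + ‖y‖ → (‖h‖ ^ p)⁻¹ * ‖f y‖ ≤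
        (C * (‖h‖ ^ p)⁻¹ + 2 ^ p * ‖f y‖) * ‖x‖ ^ (-p) := fun y hy => by
      rcases le_or_gt (‖x‖ / 2) ‖y‖ with hy' | hy'
      · calc _ ≤ (‖h‖ ^ p)⁻¹ * (C * ‖x‖ ^ (-p)) := by gcongr; exact hf x y hx hy'
          _ = C * (‖h‖ ^ p)⁻¹ * ‖x‖ ^ (-p) := by ring
          _ ≤ _ := by
            gcongr
            exact le_add_of_nonneg_right (by positivity)
      · have hxh : (‖h‖ ^ p)⁻¹ ≤ 2 ^ p * ‖x‖ ^ (-p) := by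
          calc (‖h‖ ^ p)⁻¹ ≤ ((‖x‖ / 2) ^ p)⁻¹ := by
                gcongr
                linarith
            _ = _ := by
                rw [Real.div_rpow hx0.le (by norm_num), Real.rpow_neg hx0.le, inv_div,
                  div_eq_mul_inv]
        calc _ ≤ 2 ^ p * ‖x‖ ^ (-p) * ‖f y‖ := by gcongr
          _ = 2 ^ p * ‖f y‖ * ‖x‖ ^ (-p) := by ring
          _ ≤ _ := by
            gcongr
            exact le_add_of_nonneg_left (by positivity)
    have h1 := key (x + h) (by
      have := norm_sub_le (x + h) h
      rw [add_sub_cancel_right] at this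
      linarith)
    have h2 := key (x - h) (by
      have := norm_add_le (x - h) h
      rw [sub_add_cancel] at this
      linarith)
    have h3 : (‖h‖ ^ p)⁻¹ * ‖f x‖ ≤ (‖h‖ ^ p)⁻¹ * (C * ‖x‖ ^ (-p)) := by
      gcongr
      exact hf x x hx (by linarith)
    have h4 : 0 ≤ C₂ * (‖h‖ ^ p)⁻¹ * ‖x‖ ^ (-p) := by positivity
    have htri : ‖(2 : ℝ) • f x - f (x + h) - f (x - h)‖ ≤
        2 * ‖f x‖ + ‖f (x + h)‖ + ‖f (x - h)‖ := by
      refine (norm_sub_le _ _).trans ?_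
      gcongr
      refine (norm_sub_le _ _).trans ?_
      rw [norm_smul, Real.norm_ofNat]
    rw [hker]
    calc _ ≤ (‖h‖ ^ p)⁻¹ * (2 * ‖f x‖ + ‖f (x + h)‖ + ‖f (x - h)‖) := by gcongr
      _ ≤ _ := by linarith

/-- Any integral whose integrand is dominated by the singular second-order difference quotient of
a Schwartz map is `O(‖x‖ ^ (-p))`. -/
lemma SchwartzMap.exists_norm_integral_second_diff_le {E F G : Type*} [NormedAddCommGroup E]
    [NormedSpace ℝ E] [FiniteDimensional ℝ E] [Nontrivial E] [MeasurableSpace E] [BorelSpace E]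
    (ν : Measure E) [ν.IsAddHaarMeasure] [NormedAddCommGroup F] [NormedSpace ℝ F]
    [NormedAddCommGroup G] [NormedSpace ℝ G] (f : SchwartzMap E F) {p : ℝ}
    (hp : Module.finrank ℝ E < p) (hp' : p < Module.finrank ℝ E + 2) :
    ∃ C : ℝ, ∀ (x : E) (g : E → G), 1 ≤ ‖x‖ →
      (∀ h, ‖g h‖ ≤ (‖h‖ ^ p)⁻¹ * ‖(2 : ℝ) • f x - f (x + h) - f (x - h)‖) →
      ‖∫ h, g h ∂ν‖ ≤ C * ‖x‖ ^ (-p) := by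
  obtain ⟨C, hC⟩ := f.exists_kernel_second_diff_le ((Nat.cast_nonneg _).trans_lt hp)
  have hφ := (integrable_levyKernel_norm ν hp hp').const_mul C
  have hf : Integrable (fun y => ‖f y‖) ν := f.integrable.norm
  refine ⟨C * ∫ h, levyKernel p ‖h‖ ∂ν + 2 ^ p * (∫ y, ‖f y‖ ∂ν + ∫ y, ‖f y‖ ∂ν),
    fun x g hx hg => ?_⟩
  have hadd : Integrable (fun h => ‖f (x + h)‖) ν := hf.comp_add_left x
  have hsub : Integrable (fun h => ‖f (x - h)‖) ν := hf.comp_sub_left x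
  have hsum : Integrable (fun h => 2 ^ p * (‖f (x + h)‖ + ‖f (x - h)‖)) ν :=
    (hadd.add hsub).const_mul _
  refine (norm_integral_le_of_norm_le ((hφ.add hsum).mul_const (‖x‖ ^ (-p)))
    (Filter.Eventually.of_forall fun h => (hg h).trans (hC x h hx))).trans_eq ?_
  simp only [Pi.add_apply]
  rw [integral_mul_const, integral_add hφ hsum, integral_const_mul, integral_const_mul,
    integral_add hadd hsub, integral_add_left_eq_self (fun y => ‖f y‖) x,
    integral_sub_left_eq_self (fun y => ‖f y‖) ν x]

/-- Decay of `𝕃^s u` for Schwartz `u`: `|𝕃^s u(x)| ≤ C|x|^{−d−2s}` for `|x| ≥ 1`. -/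
theorem lameFrac_decay (d : ℕ) (hd : 2 ≤ d) (s : ℝ) (hs : s ∈ Set.Ioo (0 : ℝ) 1)
    (μ lam : ℝ) (hμ : 0 < μ) (hlam : 0 < 2 * μ + lam)
    (u : SchwartzMap (EuclideanSpace ℝ (Fin d)) (EuclideanSpace ℝ (Fin d))) :
    ∃ C : ℝ, ∀ x : EuclideanSpace ℝ (Fin d), 1 ≤ ‖x‖ →
      ‖lameFrac d s μ lam u x‖ ≤ C * ‖x‖ ^ (-((d : ℝ) + 2 * s)) := by
  obtain ⟨hs0, hs1⟩ := hs
  have : Nontrivial (EuclideanSpace ℝ (Fin d)) :=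
    Module.nontrivial_of_finrank_pos (R := ℝ) (by rw [finrank_euclideanSpace_fin]; omega)
  obtain ⟨C, hC⟩ := u.exists_norm_integral_second_diff_le (G := EuclideanSpace ℝ (Fin d)) volume
    (p := (d : ℝ) + 2 * s) (by rw [finrank_euclideanSpace_fin]; linarith)
    (by rw [finrank_euclideanSpace_fin]; linarith)
  unfold lameFrac
  set a := ((2 * s + 1) * μ ^ s - (2 * μ + lam) ^ s) / (2 * s) * (cConst d s / 2)
  set b := ((2 * μ + lam) ^ s - μ ^ s) / (2 * s) * (kappaConst d s / 2)
  refine ⟨‖a‖ * C + ‖b‖ * C, fun x hx => ?_⟩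
  rw [add_mul, mul_assoc, mul_assoc]
  refine (norm_add_le _ _).trans ?_
  rw [norm_smul, norm_smul]
  gcongr
  · refine hC x _ hx fun h => ?_
    rw [norm_smul, Real.norm_of_nonneg (by positivity)]
  · refine hC x _ hx fun h => ?_
    set v := (2 : ℝ) • u x - u (x + h) - u (x - h)
    rcases eq_or_ne h 0 with rfl | hh
    · rw [smul_zero, norm_zero]
      positivity
    · have h0 : 0 < ‖h‖ := norm_pos_iff.mpr hh
      have hin : ‖⟪h, v⟫‖ ≤ ‖h‖ * ‖v‖ := norm_inner_le_norm h v
      rw [norm_smul, norm_div, Real.norm_of_nonneg (show 0 ≤ ‖h‖ ^ 2 * ‖h‖ ^ ((d : ℝ) + 2 * s)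
        by positivity)]
      calc _ ≤ ‖h‖ * ‖v‖ / (‖h‖ ^ 2 * ‖h‖ ^ ((d : ℝ) + 2 * s)) * ‖h‖ := by gcongr
        _ = _ := by field_simp
end
end

section
/- Let d ≥ 3, μ > 0, 2μ + λ > 0, and set Ψ(x) := (Γ(d/2)/(4π^{d/2} μ(2μ+λ))) [ (3μ+λ)/(d−2) · |x|^{2−d} I + (μ+λ) |x|^{2−d} (x⊗x)/|x|² ] (the fundamental solution of the Lamé–Navier operator 𝕃 = −μΔ − (μ+λ)∇div). Let f : ℝ^d → ℝ^d be bounded and measurable and define v(x) := ∫_{B(0,2)} Ψ(x−z) f(z) dz. Then v is differentiable at every point of B(0,1/2) and there exists C = C(d, μ, λ) such that for all x ≠ y in B(0,1/2), |∇v(x) − ∇v(y)| ≤ C (sup_{B(0,2)}|f|) · |x−y| · ln(2/|x−y|). Consequently, for every α ∈ (0,1) there exists C_α = C(d, μ, λ, α) such that |∇v(x) − ∇v(y)| ≤ C_α (sup_{B(0,2)}|f|) |x−y|^α on B(0,1/2). -/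
open Real MeasureTheory
open scoped RealInnerProductSpace

noncomputable section

/-- The fundamental solution `Ψ` of the Lamé–Navier operator applied to a vector `w`:
`Ψ(z)w = (Γ(d/2)/(4π^{d/2}μ(2μ+λ))) [ (3μ+λ)/(d−2) |z|^{2−d} w + (μ+λ)|z|^{2−d} (z·w/|z|²) z ]`. -/
def lameFundamentalApply (d : ℕ) (μ lam : ℝ) (z w : EuclideanSpace ℝ (Fin d)) :
    EuclideanSpace ℝ (Fin d) :=
  (Real.Gamma ((d : ℝ) / 2) / (4 * π ^ ((d : ℝ) / 2) * μ * (2 * μ + lam))) •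
    (((3 * μ + lam) / ((d : ℝ) - 2) * ‖z‖ ^ (2 - (d : ℝ))) • w +
      ((μ + lam) * ‖z‖ ^ (2 - (d : ℝ)) * (⟪z, w⟫ / ‖z‖ ^ 2)) • z)

/-- The Newtonian-type potential `v(x) = ∫_{B(0,2)} Ψ(x−z) f(z) dz`. -/
def lamePotential (d : ℕ) (μ lam : ℝ)
    (f : EuclideanSpace ℝ (Fin d) → EuclideanSpace ℝ (Fin d))
    (x : EuclideanSpace ℝ (Fin d)) : EuclideanSpace ℝ (Fin d) :=
  ∫ z in Metric.ball (0 : EuclideanSpace ℝ (Fin d)) 2,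
    lameFundamentalApply d μ lam (x - z) (f z)

section Auxiliary

open Set

/-- `F` is positively homogeneous of degree `s`. -/
def PosHomogeneous {E G : Type*} [NormedAddCommGroup E] [NormedSpace ℝ E] [NormedAddCommGroup G]
    [NormedSpace ℝ G] (s : ℝ) (F : E → G) : Prop :=
  ∀ t : ℝ, 0 < t → ∀ z, F (t • z) = t ^ s • F z

namespace PosHomogeneous

variable {E G : Type*} [NormedAddCommGroup E] [NormedSpace ℝ E] [NormedAddCommGroup G]
  [NormedSpace ℝ G] {F : E → G} {s : ℝ}

theorem fderiv (hF : PosHomogeneous s F) : PosHomogeneous (s - 1) (fderiv ℝ F) := by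
  intro t ht z
  have h1 : _root_.fderiv ℝ (fun z => F (t • z)) z = _root_.fderiv ℝ (t ^ s • F) z := by
    congr 1
    funext z
    exact hF t ht z
  rw [fderiv_comp_smul, fderiv_const_smul_field, Pi.smul_apply] at h1
  rw [rpow_sub_one ht.ne', div_eq_inv_mul, mul_smul, ← h1, smul_smul, inv_mul_cancel₀ ht.ne',
    one_smul]

theorem apply_zero (hF : PosHomogeneous s F) (hs : s ≠ 0) : F 0 = 0 := by
  have h := hF 2 two_pos 0
  rw [smul_zero] at h
  have h2 : ((2 : ℝ) ^ s - 1) • F 0 = 0 := by rw [sub_smul, one_smul, ← h, sub_self]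
  refine (smul_eq_zero.1 h2).resolve_left fun h3 => hs ?_
  have h4 := log_rpow two_pos s
  rw [sub_eq_zero.1 h3, log_one] at h4
  exact (mul_eq_zero.1 h4.symm).resolve_right (log_pos one_lt_two).ne'

theorem exists_norm_le [FiniteDimensional ℝ E] (hF : PosHomogeneous s F) (hs : s ≠ 0)
    (hc : ContinuousOn F {0}ᶜ) : ∃ c : ℝ, 0 < c ∧ ∀ z, ‖F z‖ ≤ c * ‖z‖ ^ s := by
  obtain ⟨C, hC⟩ := (isCompact_sphere (0 : E) 1).exists_bound_of_continuousOn
    (hc.mono fun z hz => by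
      rintro rfl
      simp at hz)
  refine ⟨max C 1, by positivity, fun z => ?_⟩
  rcases eq_or_ne z 0 with rfl | hz
  · rw [hF.apply_zero hs, norm_zero]
    positivity
  have hz' : 0 < ‖z‖ := norm_pos_iff.2 hz
  have h1 : F z = ‖z‖ ^ s • F (‖z‖⁻¹ • z) := by
    rw [← hF _ hz', smul_smul, mul_inv_cancel₀ hz'.ne', one_smul]
  rw [h1, norm_smul, norm_of_nonneg (by positivity), mul_comm]
  gcongr
  refine (hC _ ?_).trans (le_max_left _ _)
  simp [norm_smul, hz'.ne']

end PosHomogeneous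

section Kernel

variable {E G : Type*} [NormedAddCommGroup E] [NormedSpace ℝ E] [NormedAddCommGroup G]
  [NormedSpace ℝ G]

theorem norm_ge_half_of_mem_closedBall {E : Type*} [NormedAddCommGroup E] {a b ξ : E}
    (h : 2 * ‖a - b‖ ≤ ‖b‖) (hξ : ξ ∈ Metric.closedBall b ‖a - b‖) : ‖b‖ / 2 ≤ ‖ξ‖ := by
  rw [mem_closedBall_iff_norm] at hξ
  have := norm_sub_norm_le b ξ
  rw [norm_sub_rev] at this
  linarith

/-- Mean value bound away from the singularity. -/
theorem norm_sub_le_of_norm_fderiv_le_rpow {F : E → G} {c s : ℝ} (hc : 0 ≤ c) (hs : s ≤ 0)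
    (hd : ∀ z ≠ 0, DifferentiableAt ℝ F z) (hb : ∀ z, ‖fderiv ℝ F z‖ ≤ c * ‖z‖ ^ s)
    {a b : E} (hb0 : b ≠ 0) (h : 2 * ‖a - b‖ ≤ ‖b‖) :
    ‖F a - F b‖ ≤ c * (‖b‖ / 2) ^ s * ‖a - b‖ := by
  have hb' : 0 < ‖b‖ := norm_pos_iff.2 hb0
  refine (convex_closedBall b ‖a - b‖).norm_image_sub_le_of_norm_fderiv_le (𝕜 := ℝ)
    (fun ξ hξ => hd ξ ?_) (fun ξ hξ => (hb ξ).trans ?_) (by simp) (by simp [dist_eq_norm])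
  · rw [← norm_pos_iff]
    linarith [norm_ge_half_of_mem_closedBall h hξ]
  · have := norm_ge_half_of_mem_closedBall h hξ
    exact mul_le_mul_of_nonneg_left (rpow_le_rpow_of_nonpos (by positivity) this hs) hc

/-- A radial majorant for the first-order increments, at scale `δ`, of a kernel of degree
`2 - n`. -/
def incrementMajorant (n : ℕ) (δ : ℝ) (a b : E) : ℝ :=
  (Iio (3 * δ)).indicator (fun r : ℝ => r ^ (1 - n : ℝ)) ‖a‖ +
    (Iio (2 * δ)).indicator (fun r : ℝ => r ^ (1 - n : ℝ)) ‖b‖ +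
    δ * (Ico (2 * δ) 4).indicator (fun r : ℝ => r ^ (-n : ℝ)) ‖b‖

/-- Size, gradient and first-order increment bounds for a kernel that is homogeneous of degree
`2 - n` and smooth away from the origin. -/
theorem exists_increment_bounds [FiniteDimensional ℝ E] {n : ℕ} (hn : 3 ≤ n) {K : E → G}
    (hK : PosHomogeneous (2 - n) K) (hsm : ∀ z ≠ 0, ContDiffAt ℝ 2 K z) :
    ∃ c : ℝ, 0 < c ∧ (∀ z, ‖K z‖ ≤ c * ‖z‖ ^ (2 - n : ℝ)) ∧
      (∀ z, ‖fderiv ℝ K z‖ ≤ c * ‖z‖ ^ (1 - n : ℝ)) ∧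
      ∀ a b : E, a ≠ b → ‖b‖ < 4 →
        ‖fderiv ℝ K a - fderiv ℝ K b‖ ≤ c * incrementMajorant n ‖a - b‖ a b ∧
        ‖K a - K b - fderiv ℝ K b (a - b)‖ ≤
          c * ‖a - b‖ * incrementMajorant n ‖a - b‖ a b := by
  have hn' : (3 : ℝ) ≤ n := by exact_mod_cast hn
  have hsm1 : ∀ z ≠ 0, ContDiffAt ℝ 1 (fderiv ℝ K) z := fun z hz =>
    (hsm z hz).fderiv_right (by norm_num)
  have hsm0 : ∀ z ≠ 0, ContDiffAt ℝ 0 (fderiv ℝ (fderiv ℝ K)) z := fun z hz =>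
    (hsm1 z hz).fderiv_right (by norm_num)
  have hK1 := hK.fderiv
  have hK2 := hK1.fderiv
  obtain ⟨c₀, hc₀, h₀⟩ := hK.exists_norm_le (by linarith)
    fun z hz => (hsm z hz).continuousAt.continuousWithinAt
  obtain ⟨c₁, hc₁, h₁⟩ := hK1.exists_norm_le (by linarith)
    fun z hz => (hsm1 z hz).continuousAt.continuousWithinAt
  obtain ⟨c₂, hc₂, h₂⟩ := hK2.exists_norm_le (by linarith)
    fun z hz => (hsm0 z hz).continuousAt.continuousWithinAt
  rw [show (2 - n - 1 : ℝ) = 1 - n by ring] at h₁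
  rw [show (2 - n - 1 - 1 : ℝ) = -n by ring] at h₂
  have hA : 0 < (1 / 2 : ℝ) ^ (-n : ℝ) := by positivity
  set A := (1 / 2 : ℝ) ^ (-n : ℝ) with hAdef
  set c := 3 * c₀ + c₁ + c₂ * A with hc
  have hcpos : 0 < c := by positivity
  have hc₂A : 0 < c₂ * A := by positivity
  have hc0 : 3 * c₀ ≤ c := by linarith
  have hc1 : c₁ ≤ c := by linarith
  have hc2 : c₂ * A ≤ c := by linarith
  refine ⟨c, hcpos, fun z => (h₀ z).trans (by gcongr; linarith),
    fun z => (h₁ z).trans (by gcongr), fun a b hab hb4 => ?_⟩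
  set δ := ‖a - b‖ with hδ
  have hδ0 : 0 < δ := norm_pos_iff.2 (sub_ne_zero.2 hab)
  have hfar : ∀ ξ, b ≠ 0 → 2 * ‖ξ - b‖ ≤ ‖b‖ →
      ‖fderiv ℝ K ξ - fderiv ℝ K b‖ ≤ c * ‖b‖ ^ (-n : ℝ) * ‖ξ - b‖ := by
    intro ξ hb0 hξ
    refine (norm_sub_le_of_norm_fderiv_le_rpow hc₂.le (by linarith : (-n : ℝ) ≤ 0)
      (fun z hz => (hsm1 z hz).differentiableAt (by norm_num)) h₂ hb0 hξ).trans ?_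
    refine mul_le_mul_of_nonneg_right ?_ (norm_nonneg _)
    rw [div_eq_mul_one_div, mul_rpow (norm_nonneg _) (by norm_num), mul_comm (‖b‖ ^ _), ← mul_assoc]
    gcongr
  rcases le_or_gt (2 * δ) ‖b‖ with hb | hb
  · have hb0 : b ≠ 0 := norm_pos_iff.1 (by linarith)
    have hmaj : δ * ‖b‖ ^ (-n : ℝ) ≤ incrementMajorant n δ a b := by
      rw [incrementMajorant, indicator_of_mem (show ‖b‖ ∈ Ico (2 * δ) 4 from ⟨hb, hb4⟩)]
      have h1 : 0 ≤ (Iio (3 * δ)).indicator (fun r : ℝ => r ^ (1 - n : ℝ)) ‖a‖ :=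
        indicator_apply_nonneg fun _ => by positivity
      have h2 : 0 ≤ (Iio (2 * δ)).indicator (fun r : ℝ => r ^ (1 - n : ℝ)) ‖b‖ :=
        indicator_apply_nonneg fun _ => by positivity
      linarith
    constructor
    · calc _ ≤ c * ‖b‖ ^ (-n : ℝ) * δ := hfar a hb0 hb
        _ = c * (δ * ‖b‖ ^ (-n : ℝ)) := by ring
        _ ≤ _ := by gcongr
    · have := (convex_closedBall b δ).norm_image_sub_le_of_norm_fderiv_le' (𝕜 := ℝ)
        (f := K) (φ := fderiv ℝ K b) (C := c * ‖b‖ ^ (-n : ℝ) * δ) (x := b) (y := a)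
        (fun ξ hξ => (hsm ξ ?_).differentiableAt (by norm_num))
        (fun ξ hξ => ?_) (by simp [hδ0.le]) (by simp [dist_eq_norm, hδ])
      · calc _ ≤ c * ‖b‖ ^ (-n : ℝ) * δ * δ := this
          _ = c * δ * (δ * ‖b‖ ^ (-n : ℝ)) := by ring
          _ ≤ _ := by gcongr
      · rw [← norm_pos_iff]
        linarith [norm_ge_half_of_mem_closedBall hb hξ]
      · have hξ' : ‖ξ - b‖ ≤ δ := mem_closedBall_iff_norm.1 hξ
        exact (hfar ξ hb0 (by linarith)).trans (by gcongr)
  · have ha : ‖a‖ < 3 * δ := by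
      have := norm_sub_norm_le a b
      linarith
    have hmaj : incrementMajorant n δ a b = ‖a‖ ^ (1 - n : ℝ) + ‖b‖ ^ (1 - n : ℝ) := by
      rw [incrementMajorant, indicator_of_mem (show ‖b‖ ∈ Iio (2 * δ) from hb),
        indicator_of_mem (show ‖a‖ ∈ Iio (3 * δ) from ha), indicator_of_notMem, mul_zero, add_zero]
      exact fun h => absurd h.1 (not_le.2 hb)
    have hK0 : ∀ z, ‖z‖ ≤ 3 * δ → ‖K z‖ ≤ 3 * c₀ * δ * ‖z‖ ^ (1 - n : ℝ) := by
      intro z hz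
      refine (h₀ z).trans ?_
      rcases (norm_nonneg z).eq_or_lt with h | h
      · rw [← h, zero_rpow (by linarith)]
        simpa using by positivity
      · rw [show (2 - n : ℝ) = 1 + (1 - n) by ring, rpow_add h, rpow_one, ← mul_assoc]
        refine mul_le_mul_of_nonneg_right ?_ (by positivity)
        nlinarith
    rw [hmaj]
    have hpa : 0 ≤ ‖a‖ ^ (1 - n : ℝ) := by positivity
    have hpb : 0 ≤ ‖b‖ ^ (1 - n : ℝ) := by positivity
    constructor
    · calc _ ≤ ‖fderiv ℝ K a‖ + ‖fderiv ℝ K b‖ := norm_sub_le _ _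
        _ ≤ c₁ * ‖a‖ ^ (1 - n : ℝ) + c₁ * ‖b‖ ^ (1 - n : ℝ) := add_le_add (h₁ a) (h₁ b)
        _ = c₁ * (‖a‖ ^ (1 - n : ℝ) + ‖b‖ ^ (1 - n : ℝ)) := by ring
        _ ≤ _ := by gcongr
    · calc _ ≤ ‖K a‖ + ‖K b‖ + ‖fderiv ℝ K b‖ * δ :=
            (norm_sub_le _ _).trans (add_le_add (norm_sub_le _ _)
              (ContinuousLinearMap.le_opNorm _ _))
        _ ≤ 3 * c₀ * δ * ‖a‖ ^ (1 - n : ℝ) + 3 * c₀ * δ * ‖b‖ ^ (1 - n : ℝ) +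
              c₁ * ‖b‖ ^ (1 - n : ℝ) * δ := by
            gcongr
            · exact hK0 a ha.le
            · exact hK0 b (by linarith)
            · exact h₁ b
        _ ≤ (3 * c₀ + c₁) * δ * (‖a‖ ^ (1 - n : ℝ) + ‖b‖ ^ (1 - n : ℝ)) := by
            have : 0 ≤ c₁ * δ * ‖a‖ ^ (1 - n : ℝ) := by positivity
            linarith
        _ ≤ _ := by
            gcongr
            linarith

end Kernel

section Radial

variable {E : Type*} [NormedAddCommGroup E] [NormedSpace ℝ E] [FiniteDimensional ℝ E]
  [MeasurableSpace E] [BorelSpace E] (μ : Measure E) [μ.IsAddHaarMeasure]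

theorem pow_sub_one_mul_rpow_one_sub {n : ℕ} (hn : 1 ≤ n) {y : ℝ} (hy : 0 < y) :
    y ^ (n - 1) * y ^ (1 - n : ℝ) = 1 := by
  rw [← rpow_natCast, ← rpow_add hy, Nat.cast_sub hn]
  simp

theorem pow_sub_one_mul_rpow_neg {n : ℕ} (hn : 1 ≤ n) {y : ℝ} (hy : 0 < y) :
    y ^ (n - 1) * y ^ (-n : ℝ) = y⁻¹ := by
  rw [← rpow_natCast, ← rpow_add hy, Nat.cast_sub hn, ← rpow_neg_one]
  congr 1
  push_cast
  ring

theorem integrable_and_integral_indicator_Iio_rpow_norm {n : ℕ}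
    (hE : Module.finrank ℝ E = n) (hn : 1 ≤ n) {ρ : ℝ} (hρ : 0 ≤ ρ) :
    Integrable (fun z : E => (Iio ρ).indicator (fun r : ℝ => r ^ (1 - n : ℝ)) ‖z‖) μ ∧
      ∫ z : E, (Iio ρ).indicator (fun r : ℝ => r ^ (1 - n : ℝ)) ‖z‖ ∂μ =
        n * μ.real (Metric.ball 0 1) * ρ := by
  have : Nontrivial E := Module.nontrivial_of_finrank_pos (R := ℝ) (by omega)
  have key : EqOn (fun y : ℝ => y ^ (Module.finrank ℝ E - 1) •
      (Iio ρ).indicator (fun r : ℝ => r ^ (1 - n : ℝ)) y)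
      ((Iio ρ).indicator fun _ => (1 : ℝ)) (Ioi 0) := by
    intro y hy
    by_cases h : y ∈ Iio ρ
    · simp only [indicator_of_mem h, smul_eq_mul, hE]
      exact pow_sub_one_mul_rpow_one_sub hn hy
    · simp [indicator_of_notMem h]
  constructor
  · rw [integrable_fun_norm_addHaar μ, integrableOn_congr_fun key measurableSet_Ioi]
    rw [IntegrableOn, integrable_indicator_iff measurableSet_Iio, IntegrableOn,
      Measure.restrict_restrict measurableSet_Iio, inter_comm, Ioi_inter_Iio]
    simp
  · rw [integral_fun_norm_addHaar μ, setIntegral_congr_fun measurableSet_Ioi key,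
      setIntegral_indicator measurableSet_Iio, Ioi_inter_Iio]
    simp [hE, hρ]
    ring

theorem integrable_and_integral_indicator_Ico_rpow_norm {n : ℕ}
    (hE : Module.finrank ℝ E = n) (hn : 1 ≤ n) {ρ R : ℝ} (hρ : 0 < ρ) (hR : ρ ≤ R) :
    Integrable (fun z : E => (Ico ρ R).indicator (fun r : ℝ => r ^ (-n : ℝ)) ‖z‖) μ ∧
      ∫ z : E, (Ico ρ R).indicator (fun r : ℝ => r ^ (-n : ℝ)) ‖z‖ ∂μ =
        n * μ.real (Metric.ball 0 1) * log (R / ρ) := by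
  have : Nontrivial E := Module.nontrivial_of_finrank_pos (R := ℝ) (by omega)
  have key : EqOn (fun y : ℝ => y ^ (Module.finrank ℝ E - 1) •
      (Ico ρ R).indicator (fun r : ℝ => r ^ (-n : ℝ)) y)
      ((Ico ρ R).indicator fun y => y⁻¹) (Ioi 0) := by
    intro y hy
    by_cases h : y ∈ Ico ρ R
    · simp only [indicator_of_mem h, smul_eq_mul, hE]
      exact pow_sub_one_mul_rpow_neg hn hy
    · simp [indicator_of_notMem h]
  have hsub : Ioi 0 ∩ Ico ρ R = Ico ρ R :=
    inter_eq_right.2 fun y hy => hρ.trans_le hy.1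
  constructor
  · rw [integrable_fun_norm_addHaar μ, integrableOn_congr_fun key measurableSet_Ioi]
    rw [IntegrableOn, integrable_indicator_iff measurableSet_Ico, IntegrableOn,
      Measure.restrict_restrict measurableSet_Ico, inter_comm, hsub]
    refine IntegrableOn.mono_set (t := Icc ρ R) ?_ Ico_subset_Icc_self
    refine ContinuousOn.integrableOn_Icc (ContinuousOn.inv₀ continuousOn_id fun y hy => ?_)
    exact (hρ.trans_le hy.1).ne'
  · rw [integral_fun_norm_addHaar μ, setIntegral_congr_fun measurableSet_Ioi key,
      setIntegral_indicator measurableSet_Ico, hsub, integral_Ico_eq_integral_Ioo,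
      ← integral_Ioc_eq_integral_Ioo, ← intervalIntegral.integral_of_le hR,
      integral_inv_of_pos hρ (hρ.trans_le hR), hE]
    simp [mul_assoc]

theorem integrable_and_integral_incrementMajorant_le {n : ℕ}
    (hE : Module.finrank ℝ E = n) (hn : 1 ≤ n) {δ : ℝ} (hδ : 0 < δ) (hδ1 : δ ≤ 1) (x y : E) :
    Integrable (fun z => incrementMajorant n δ (x - z) (y - z)) μ ∧
      ∫ z, incrementMajorant n δ (x - z) (y - z) ∂μ ≤
        11 * (n * μ.real (Metric.ball (0 : E) 1)) * (δ * log (2 / δ)) := by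
  obtain ⟨i₁, e₁⟩ := integrable_and_integral_indicator_Iio_rpow_norm μ hE hn
    (ρ := 3 * δ) (by positivity)
  obtain ⟨i₂, e₂⟩ := integrable_and_integral_indicator_Iio_rpow_norm μ hE hn
    (ρ := 2 * δ) (by positivity)
  obtain ⟨i₃, e₃⟩ := integrable_and_integral_indicator_Ico_rpow_norm μ hE hn
    (ρ := 2 * δ) (R := 4) (by positivity) (by linarith)
  rw [← integral_sub_left_eq_self _ μ x] at e₁
  rw [← integral_sub_left_eq_self _ μ y] at e₂ e₃
  replace i₁ := i₁.comp_sub_left x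
  replace i₂ := i₂.comp_sub_left y
  replace i₃ := (i₃.comp_sub_left y).const_mul δ
  refine ⟨(i₁.add i₂).add i₃, ?_⟩
  have hlog : log 2 ≤ log (2 / δ) := by
    refine log_le_log two_pos ?_
    rw [le_div_iff₀ hδ]
    linarith
  have hl2 : (1 / 2 : ℝ) ≤ log 2 := by linarith [log_two_gt_d9]
  have hω : 0 ≤ n * μ.real (Metric.ball (0 : E) 1) := by positivity
  unfold incrementMajorant
  rw [integral_add (i₁.fun_add i₂) i₃, integral_add i₁ i₂, integral_const_mul, e₁, e₂, e₃,
    show (4 : ℝ) / (2 * δ) = 2 / δ by field_simp; norm_num]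
  have : δ * (1 / 2) ≤ δ * log (2 / δ) := by gcongr; linarith
  nlinarith

end Radial

section Potential

variable {E F H : Type*} [NormedAddCommGroup E] [NormedSpace ℝ E] [FiniteDimensional ℝ E]
  [MeasurableSpace E] [BorelSpace E] [NormedAddCommGroup F] [NormedSpace ℝ F]
  [NormedAddCommGroup H] [NormedSpace ℝ H]
  (μ : Measure E) [μ.IsAddHaarMeasure]

theorem aestronglyMeasurable_comp_sub_left [Nontrivial E] {G : Type*} [NormedAddCommGroup G]
    {k : E → G} (hk : ContinuousOn k {0}ᶜ) (x : E) :
    AEStronglyMeasurable (fun z => k (x - z)) μ := by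
  have h : AEStronglyMeasurable k μ := by
    have := hk.aestronglyMeasurable (μ := μ) (measurableSet_singleton 0).compl
    rwa [restrict_compl_singleton] at this
  exact h.comp_measurePreserving (Measure.measurePreserving_sub_left μ x)

theorem integrable_clm_apply_of_norm_le_rpow {n : ℕ} (hE : Module.finrank ℝ E = n) (hn : 1 ≤ n)
    {k : E → F →L[ℝ] H} (hk : ContinuousOn k {0}ᶜ) {c : ℝ} {s : ℝ} (hs : 1 - n ≤ s) (hs0 : s ≠ 0)
    (hkc : ∀ z, ‖k z‖ ≤ c * ‖z‖ ^ s) {f : E → F} (hf : AEStronglyMeasurable f μ) {M : ℝ}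
    (hM : ∀ z ∈ Metric.ball (0 : E) 2, ‖f z‖ ≤ M) {x : E} (hx : x ∈ Metric.ball (0 : E) (1 / 2)) :
    IntegrableOn (fun z => k (x - z) (f z)) (Metric.ball (0 : E) 2) μ := by
  have : Nontrivial E := Module.nontrivial_of_finrank_pos (R := ℝ) (by omega)
  have hM0 : 0 ≤ M := (norm_nonneg _).trans (hM 0 (by simp))
  obtain ⟨i, -⟩ := integrable_and_integral_indicator_Iio_rpow_norm μ hE hn (ρ := 4) (by norm_num)
  replace i := (((i.comp_sub_left x).const_mul (|c| * 4 ^ (s - (1 - n)) * M))).integrableOn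
    (s := Metric.ball (0 : E) 2)
  refine Integrable.mono' i ?_ ?_
  · exact (ContinuousLinearMap.id ℝ (F →L[ℝ] H)).aestronglyMeasurable_comp₂
      (aestronglyMeasurable_comp_sub_left μ hk x).restrict hf.restrict
  · refine (ae_restrict_iff' Metric.isOpen_ball.measurableSet).2 (.of_forall fun z hz => ?_)
    have hz4 : ‖x - z‖ < 4 := by
      rw [mem_ball_zero_iff] at hx hz
      linarith [norm_sub_le x z]
    rw [indicator_of_mem (show ‖x - z‖ ∈ Iio 4 from hz4)]
    have h1 : ‖x - z‖ ^ s ≤ 4 ^ (s - (1 - n)) * ‖x - z‖ ^ (1 - n : ℝ) := by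
      rcases (norm_nonneg (x - z)).eq_or_lt with h | h
      · rw [← h, zero_rpow hs0]
        positivity
      · rw [show s = (s - (1 - n)) + (1 - n) by ring, rpow_add h, add_sub_cancel_right]
        gcongr
    calc ‖k (x - z) (f z)‖ ≤ ‖k (x - z)‖ * ‖f z‖ := (k (x - z)).le_opNorm _
      _ ≤ |c| * (4 ^ (s - (1 - n)) * ‖x - z‖ ^ (1 - n : ℝ)) * M := by
          gcongr
          · refine (hkc _).trans ?_
            gcongr
            exact le_abs_self c
          · exact hM z hz
      _ = _ := by ring

theorem norm_setIntegral_le_of_incrementMajorant {n : ℕ} (hE : Module.finrank ℝ E = n) (hn : 1 ≤ n)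
    {x y : E} (hx : x ∈ Metric.ball (0 : E) (1 / 2)) (hy : y ∈ Metric.ball (0 : E) (1 / 2))
    (hxy : x ≠ y) {T : E → H} {c : ℝ} (hc : 0 ≤ c)
    (hT : ∀ z ∈ Metric.ball (0 : E) 2, ‖T z‖ ≤ c * incrementMajorant n ‖x - y‖ (x - z) (y - z)) :
    ‖∫ z in Metric.ball (0 : E) 2, T z ∂μ‖ ≤
      c * (11 * (n * μ.real (Metric.ball (0 : E) 1))) * (‖x - y‖ * log (2 / ‖x - y‖)) := by
  have hδ1 : ‖x - y‖ ≤ 1 := by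
    rw [mem_ball_zero_iff] at hx hy
    linarith [norm_sub_le x y]
  obtain ⟨i, hi⟩ := integrable_and_integral_incrementMajorant_le μ hE hn
    (norm_pos_iff.2 (sub_ne_zero.2 hxy)) hδ1 x y
  refine (norm_integral_le_of_norm_le (i.const_mul c).integrableOn
    ((ae_restrict_iff' Metric.isOpen_ball.measurableSet).2 (.of_forall hT))).trans ?_
  refine (setIntegral_le_integral (i.const_mul c) (.of_forall fun z => ?_)).trans ?_
  · refine mul_nonneg hc (add_nonneg (add_nonneg ?_ ?_) (mul_nonneg (norm_nonneg _) ?_)) <;>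
      exact indicator_apply_nonneg fun _ => by positivity
  · rw [integral_const_mul, mul_assoc]
    gcongr

/-- The convolution of a bounded function with a kernel of degree `2 - n` has a log-Lipschitz
candidate gradient, with a quantitative first-order expansion. -/
theorem exists_potential_increment_bounds [CompleteSpace H] {n : ℕ}
    (hE : Module.finrank ℝ E = n) (hn : 3 ≤ n)
    {K : E → F →L[ℝ] H} (hK : PosHomogeneous (2 - n) K) (hsm : ∀ z ≠ 0, ContDiffAt ℝ 2 K z) :
    ∃ C : ℝ, 0 < C ∧ ∀ (f : E → F) (M : ℝ), AEStronglyMeasurable f μ →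
      (∀ z ∈ Metric.ball (0 : E) 2, ‖f z‖ ≤ M) → ∃ G : E → E →L[ℝ] H,
        ∀ x ∈ Metric.ball (0 : E) (1 / 2), ∀ y ∈ Metric.ball (0 : E) (1 / 2), x ≠ y →
          ‖G x - G y‖ ≤ C * M * (‖x - y‖ * log (2 / ‖x - y‖)) ∧
          ‖(∫ z in Metric.ball (0 : E) 2, K (x - z) (f z) ∂μ) -
              (∫ z in Metric.ball (0 : E) 2, K (y - z) (f z) ∂μ) - G y (x - y)‖ ≤
            C * M * (‖x - y‖ * log (2 / ‖x - y‖)) * ‖x - y‖ := by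
  have : Nontrivial E := Module.nontrivial_of_finrank_pos (R := ℝ) (by omega)
  have hn' : (3 : ℝ) ≤ n := by exact_mod_cast hn
  obtain ⟨c, hc, hc₀, hc₁, hinc⟩ := exists_increment_bounds hn hK hsm
  have hKc : ContinuousOn K {0}ᶜ := fun z hz => (hsm z hz).continuousAt.continuousWithinAt
  have hω : 0 < μ.real (Metric.ball (0 : E) 1) :=
    ENNReal.toReal_pos (Metric.measure_ball_pos μ 0 one_pos).ne' measure_ball_lt_top.ne
  set DK : E → F →L[ℝ] E →L[ℝ] H := fun z => (fderiv ℝ K z).flip with hDK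
  have hDKc : ContinuousOn DK {0}ᶜ := fun z hz =>
    ((ContinuousLinearMap.flipₗᵢ ℝ E F H).continuous.continuousAt.comp
      ((hsm z hz).fderiv_right (m := 1) (by norm_num)).continuousAt).continuousWithinAt
  have hDKn : ∀ z, ‖DK z‖ ≤ c * ‖z‖ ^ (1 - n : ℝ) := fun z => by
    rw [hDK, ContinuousLinearMap.opNorm_flip]
    exact hc₁ z
  refine ⟨c * (11 * (n * μ.real (Metric.ball (0 : E) 1))), by positivity,
    fun f M hf hM => ⟨fun x => ∫ z in Metric.ball (0 : E) 2, DK (x - z) (f z) ∂μ,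
      fun x hx y hy hxy => ?_⟩⟩
  have hM0 : 0 ≤ M := (norm_nonneg _).trans (hM 0 (by simp))
  have iK : ∀ x ∈ Metric.ball (0 : E) (1 / 2),
      IntegrableOn (fun z => K (x - z) (f z)) (Metric.ball (0 : E) 2) μ := fun x hx =>
    integrable_clm_apply_of_norm_le_rpow μ hE (by omega) hKc (by linarith) (by linarith) hc₀
      hf hM hx
  have iD : ∀ x ∈ Metric.ball (0 : E) (1 / 2),
      IntegrableOn (fun z => DK (x - z) (f z)) (Metric.ball (0 : E) 2) μ := fun x hx =>
    integrable_clm_apply_of_norm_le_rpow μ hE (by omega) hDKc le_rfl (by linarith) hDKn hf hM hx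
  have hz : ∀ z ∈ Metric.ball (0 : E) 2, _ := fun z hz =>
    hinc (x - z) (y - z) (by simpa using hxy) (by
      rw [mem_ball_zero_iff] at hy hz
      linarith [norm_sub_le y z])
  simp only [sub_sub_sub_cancel_right] at hz
  constructor
  · rw [← integral_sub (iD x hx) (iD y hy)]
    refine (norm_setIntegral_le_of_incrementMajorant μ hE (by omega) hx hy hxy
      (c := c * M) (by positivity) fun z hzb => ?_).trans_eq (by ring)
    rw [← sub_apply]
    calc _ ≤ ‖DK (x - z) - DK (y - z)‖ * ‖f z‖ := ContinuousLinearMap.le_opNorm _ _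
      _ ≤ (c * incrementMajorant n ‖x - y‖ (x - z) (y - z)) * M := by
          refine mul_le_mul ?_ (hM z hzb) (norm_nonneg _) ((norm_nonneg _).trans (hz z hzb).1)
          have h := ContinuousLinearMap.opNorm_flip (fderiv ℝ K (x - z) - fderiv ℝ K (y - z))
          exact h.trans_le (hz z hzb).1
      _ = _ := by ring
  · rw [ContinuousLinearMap.integral_apply (iD y hy), ← integral_sub (iK x hx) (iK y hy),
      ← integral_sub ((iK x hx).fun_sub (iK y hy)) ((iD y hy).apply_continuousLinearMap _)]
    refine (norm_setIntegral_le_of_incrementMajorant μ hE (by omega) hx hy hxy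
      (c := c * M * ‖x - y‖) (by positivity) fun z hzb => ?_).trans_eq (by ring)
    calc _ = ‖(K (x - z) - K (y - z) - fderiv ℝ K (y - z) (x - y)) (f z)‖ := rfl
      _ ≤ ‖K (x - z) - K (y - z) - fderiv ℝ K (y - z) (x - y)‖ * ‖f z‖ :=
          ContinuousLinearMap.le_opNorm _ _
      _ ≤ (c * ‖x - y‖ * incrementMajorant n ‖x - y‖ (x - z) (y - z)) * M :=
          mul_le_mul (hz z hzb).2 (hM z hzb) (norm_nonneg _) ((norm_nonneg _).trans (hz z hzb).2)
      _ = _ := by ring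

end Potential

theorem mul_log_two_div_le_rpow {α δ : ℝ} (hα : α < 1) (hδ : 0 ≤ δ) :
    δ * log (2 / δ) ≤ 2 ^ (1 - α) / (1 - α) * δ ^ α := by
  rcases hδ.eq_or_lt with rfl | hδ
  · have : 0 < 1 - α := by linarith
    simpa using by positivity
  have h1 : δ * (2 / δ) ^ (1 - α) = 2 ^ (1 - α) * δ ^ α := by
    rw [div_rpow two_pos.le hδ.le, rpow_sub hδ, rpow_one]
    field_simp
  calc δ * log (2 / δ) ≤ δ * ((2 / δ) ^ (1 - α) / (1 - α)) := by
        gcongr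
        exact log_le_rpow_div (by positivity) (by linarith)
    _ = δ * (2 / δ) ^ (1 - α) / (1 - α) := by ring
    _ = _ := by rw [h1]; ring

theorem hasFDerivAt_of_norm_sub_sub_le_log {E H : Type*} [NormedAddCommGroup E] [NormedSpace ℝ E]
    [NormedAddCommGroup H] [NormedSpace ℝ H] {v : E → H} {L : E →L[ℝ] H} {y : E} {C : ℝ}
    (h : ∀ᶠ x in nhds y, ‖v x - v y - L (x - y)‖ ≤
      C * (‖x - y‖ * log (2 / ‖x - y‖)) * ‖x - y‖) : HasFDerivAt v L y := by
  rw [hasFDerivAt_iff_isLittleO]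
  have hcont : Continuous fun δ : ℝ => δ * log (2 / δ) := by
    have : (fun δ : ℝ => δ * log (2 / δ)) = fun δ => δ * log 2 + negMulLog δ := by
      funext δ
      rcases eq_or_ne δ 0 with rfl | hδ
      · simp
      · rw [log_div two_ne_zero hδ, negMulLog]
        ring
    rw [this]
    exact (continuous_id.mul continuous_const).add continuous_negMulLog
  have ht : Filter.Tendsto (fun x => C * (‖x - y‖ * log (2 / ‖x - y‖))) (nhds y) (nhds 0) := by
    have : Continuous fun x => C * (‖x - y‖ * log (2 / ‖x - y‖)) :=
      continuous_const.mul (hcont.comp (continuous_id.sub continuous_const).norm)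
    simpa using this.tendsto y
  have ho : (fun x => C * (‖x - y‖ * log (2 / ‖x - y‖)) * ‖x - y‖) =o[nhds y] fun x => x - y := by
    have := ((Asymptotics.isLittleO_one_iff ℝ).2 ht).mul_isBigO
      (Asymptotics.isBigO_refl (fun x => ‖x - y‖) (nhds y))
    simpa using this.norm_right
  refine Asymptotics.IsBigO.trans_isLittleO (.of_bound 1 ?_) ho
  filter_upwards [h] with x hx
  rw [one_mul]
  exact hx.trans (le_norm_self _)

section Lame

variable {E : Type*} [NormedAddCommGroup E] [InnerProductSpace ℝ E]

/-- The kernel `z ↦ ‖z‖^s (p I + q (z ⊗ z) / ‖z‖²)`. -/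
def rieszTensorKernel (p q s : ℝ) (z : E) : E →L[ℝ] E :=
  ‖z‖ ^ s • (p • ContinuousLinearMap.id ℝ E + (q * (‖z‖ ^ 2)⁻¹) • (innerSL ℝ z).smulRight z)

theorem posHomogeneous_rieszTensorKernel (p q s : ℝ) :
    PosHomogeneous s (rieszTensorKernel (E := E) p q s) := by
  intro t ht z
  ext1 w
  have h : q * ((t * ‖z‖) ^ 2)⁻¹ * (t * ⟪z, w⟫ * t) = q * (‖z‖ ^ 2)⁻¹ * ⟪z, w⟫ := by
    field_simp
  simp only [rieszTensorKernel, norm_smul, norm_of_nonneg ht.le, mul_rpow ht.le (norm_nonneg z),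
    smul_apply, add_apply, ContinuousLinearMap.smulRight_apply, innerSL_apply_apply,
    inner_smul_left, smul_smul, RCLike.conj_to_real, h]

theorem contDiffAt_rieszTensorKernel (p q s : ℝ) {z : E} (hz : z ≠ 0) :
    ContDiffAt ℝ 2 (rieszTensorKernel p q s) z := by
  have hn : ContDiffAt ℝ 2 (fun z : E => ‖z‖) z := contDiffAt_norm ℝ hz
  have hz' := norm_ne_zero_iff.2 hz
  refine (hn.rpow_const_of_ne hz').smul (contDiffAt_const.add
    ((contDiffAt_const.mul ((hn.pow 2).inv (pow_ne_zero 2 hz'))).smul ?_))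
  exact (innerSL ℝ (E := E)).contDiff.contDiffAt.smulRight contDiffAt_id

end Lame

theorem lameFundamentalApply_eq (d : ℕ) (μ lam : ℝ) (z w : EuclideanSpace ℝ (Fin d)) :
    lameFundamentalApply d μ lam z w =
      rieszTensorKernel
        (Gamma (d / 2) / (4 * π ^ ((d : ℝ) / 2) * μ * (2 * μ + lam)) * ((3 * μ + lam) / (d - 2)))
        (Gamma (d / 2) / (4 * π ^ ((d : ℝ) / 2) * μ * (2 * μ + lam)) * (μ + lam)) (2 - d) z w := by
  simp only [lameFundamentalApply, rieszTensorKernel, smul_apply, add_apply,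
    ContinuousLinearMap.smulRight_apply, innerSL_apply_apply, ContinuousLinearMap.id_apply,
    smul_add, smul_smul]
  congr 2 <;> ring

theorem exists_lamePotential_bounds {d : ℕ} (hd : 3 ≤ d) (μ lam : ℝ) :
    ∃ C : ℝ, 0 < C ∧
      ∀ (f : EuclideanSpace ℝ (Fin d) → EuclideanSpace ℝ (Fin d)) (M : ℝ), Measurable f →
        (∀ z ∈ Metric.ball (0 : EuclideanSpace ℝ (Fin d)) 2, ‖f z‖ ≤ M) →
        (∀ x ∈ Metric.ball (0 : EuclideanSpace ℝ (Fin d)) (1 / 2),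
            DifferentiableAt ℝ (lamePotential d μ lam f) x) ∧
          ∀ x ∈ Metric.ball (0 : EuclideanSpace ℝ (Fin d)) (1 / 2),
            ∀ y ∈ Metric.ball (0 : EuclideanSpace ℝ (Fin d)) (1 / 2),
              ‖fderiv ℝ (lamePotential d μ lam f) x - fderiv ℝ (lamePotential d μ lam f) y‖ ≤
                C * M * (‖x - y‖ * log (2 / ‖x - y‖)) := by
  obtain ⟨C, hC, h⟩ := exists_potential_increment_bounds
    (volume : Measure (EuclideanSpace ℝ (Fin d))) (n := d) (by simp) hd
    (posHomogeneous_rieszTensorKernel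
      (Gamma (d / 2) / (4 * π ^ ((d : ℝ) / 2) * μ * (2 * μ + lam)) * ((3 * μ + lam) / (d - 2)))
      (Gamma (d / 2) / (4 * π ^ ((d : ℝ) / 2) * μ * (2 * μ + lam)) * (μ + lam)) (2 - d))
    fun z hz => contDiffAt_rieszTensorKernel _ _ _ hz
  simp only [← lameFundamentalApply_eq] at h
  refine ⟨C, hC, fun f M hf hM => ?_⟩
  obtain ⟨G, hG⟩ := h f M hf.aestronglyMeasurable hM
  have hder : ∀ y ∈ Metric.ball (0 : EuclideanSpace ℝ (Fin d)) (1 / 2),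
      HasFDerivAt (lamePotential d μ lam f) (G y) y := fun y hy => by
    refine hasFDerivAt_of_norm_sub_sub_le_log (C := C * M) ?_
    filter_upwards [Metric.isOpen_ball.mem_nhds hy] with x hx
    rcases eq_or_ne x y with rfl | hxy
    · simp
    · exact (hG x hx y hy hxy).2
  refine ⟨fun x hx => (hder x hx).differentiableAt, fun x hx y hy => ?_⟩
  rcases eq_or_ne x y with rfl | hxy
  · simp
  rw [(hder x hx).fderiv, (hder y hy).fderiv]
  exact (hG x hx y hy hxy).1

end Auxiliary

/-- `C^{1,log}`-regularity of the Lamé–Navier potential of a bounded function: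
`v` is differentiable on `B(0,1/2)` with log-Lipschitz gradient, hence with
`α`-Hölder gradient for every `α ∈ (0,1)`. -/
theorem lamePotential_gradient_logLipschitz (d : ℕ) (hd : 3 ≤ d) (μ lam : ℝ)
    (hμ : 0 < μ) (hlam : 0 < 2 * μ + lam) :
    (∃ C : ℝ, 0 < C ∧
      ∀ (f : EuclideanSpace ℝ (Fin d) → EuclideanSpace ℝ (Fin d)) (M : ℝ),
        Measurable f → (∃ M', ∀ z, ‖f z‖ ≤ M') →
        (∀ z ∈ Metric.ball (0 : EuclideanSpace ℝ (Fin d)) 2, ‖f z‖ ≤ M) →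
        ((∀ x ∈ Metric.ball (0 : EuclideanSpace ℝ (Fin d)) (1 / 2),
            DifferentiableAt ℝ (lamePotential d μ lam f) x) ∧
          ∀ x ∈ Metric.ball (0 : EuclideanSpace ℝ (Fin d)) (1 / 2),
            ∀ y ∈ Metric.ball (0 : EuclideanSpace ℝ (Fin d)) (1 / 2), x ≠ y →
              ‖fderiv ℝ (lamePotential d μ lam f) x -
                  fderiv ℝ (lamePotential d μ lam f) y‖ ≤
                C * M * (‖x - y‖ * Real.log (2 / ‖x - y‖)))) ∧
    ∀ α ∈ Set.Ioo (0 : ℝ) 1, ∃ Cα : ℝ, 0 < Cα ∧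
      ∀ (f : EuclideanSpace ℝ (Fin d) → EuclideanSpace ℝ (Fin d)) (M : ℝ),
        Measurable f → (∃ M', ∀ z, ‖f z‖ ≤ M') →
        (∀ z ∈ Metric.ball (0 : EuclideanSpace ℝ (Fin d)) 2, ‖f z‖ ≤ M) →
        ∀ x ∈ Metric.ball (0 : EuclideanSpace ℝ (Fin d)) (1 / 2),
          ∀ y ∈ Metric.ball (0 : EuclideanSpace ℝ (Fin d)) (1 / 2),
            ‖fderiv ℝ (lamePotential d μ lam f) x -
                fderiv ℝ (lamePotential d μ lam f) y‖ ≤ Cα * M * ‖x - y‖ ^ α := by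
  obtain ⟨C, hC, h⟩ := exists_lamePotential_bounds hd μ lam
  refine ⟨⟨C, hC, fun f M hf _ hM =>
      ⟨(h f M hf hM).1, fun x hx y hy _ => (h f M hf hM).2 x hx y hy⟩⟩,
    fun α hα => ⟨C * (2 ^ (1 - α) / (1 - α)), ?_, fun f M hf _ hM x hx y hy => ?_⟩⟩
  · have : 0 < 1 - α := sub_pos.2 hα.2
    positivity
  · have hM0 : 0 ≤ M := (norm_nonneg (f 0)).trans (hM 0 (by simp))
    calc _ ≤ C * M * (‖x - y‖ * log (2 / ‖x - y‖)) := (h f M hf hM).2 x hx y hy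
      _ ≤ C * M * (2 ^ (1 - α) / (1 - α) * ‖x - y‖ ^ α) := by
          exact mul_le_mul_of_nonneg_left
            (mul_log_two_div_le_rpow hα.2 (norm_nonneg (x - y))) (by positivity)
      _ = _ := by ring
end
end

section
/- Let d ≥ 2, s ∈ (0,1), μ > 0, 2μ + λ > 0, and let P(x,t) be the Poisson kernel for the Lamé–Navier extension problem. Then P is infinitely differentiable on ℝ^d × (0,∞), and for each j ∈ {1,…,d} the j-th column U_j(x,t) := P(x,t) e_j satisfies, at every (x,t) ∈ ℝ^d × (0,∞), the degenerate elliptic system ∂_{tt} U_j + ((1−2s)/t) ∂_t U_j + μ Δ_x U_j + (μ+λ) ∇_x (div_x U_j) = 0, where Δ_x, ∇_x, div_x act in the x variables only. -/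
open Real MeasureTheory

noncomputable section

/-- The entries of the Poisson kernel `P(x,t)` for the Lamé–Navier extension problem. -/
def lamePoissonEntry (d : ℕ) (s μ lam : ℝ) (x : EuclideanSpace ℝ (Fin d)) (t : ℝ)
    (i j : Fin d) : ℝ :=
  μ ^ s * (Real.Gamma ((d : ℝ) / 2 + s) / (π ^ ((d : ℝ) / 2) * Real.Gamma s)) *
      (t ^ (2 * s) / (‖x‖ ^ 2 + μ * t ^ 2) ^ (((d : ℝ) + 2 * s) / 2)) *
      (if i = j then 1 else 0) -
    (Real.Gamma ((d : ℝ) / 2 + s) / (2 * π ^ ((d : ℝ) / 2) * Real.Gamma s)) * t ^ (2 * s) *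
      (∫ σ in μ..(2 * μ + lam),
        σ ^ (s - 1) / (‖x‖ ^ 2 + σ * t ^ 2) ^ (((d : ℝ) + 2 * s) / 2)) *
      (if i = j then 1 else 0) +
    ((d : ℝ) + 2 * s) *
      (Real.Gamma ((d : ℝ) / 2 + s) / (2 * π ^ ((d : ℝ) / 2) * Real.Gamma s)) * t ^ (2 * s) *
      (∫ σ in μ..(2 * μ + lam),
        σ ^ (s - 1) / (‖x‖ ^ 2 + σ * t ^ 2) ^ (((d : ℝ) + 2 * s + 2) / 2)) *
      (x i * x j)

/-- Partial derivative in the `k`-th coordinate direction of a scalar function on `ℝ^d`. -/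
def pder (d : ℕ) (k : Fin d) (f : EuclideanSpace ℝ (Fin d) → ℝ)
    (x : EuclideanSpace ℝ (Fin d)) : ℝ :=
  fderiv ℝ f x (EuclideanSpace.single k 1)

/-! ### Differentiation of interval integrals depending on a parameter -/

theorem hasFDerivAt_intervalIntegral_of_continuousOn {H : Type*} [NormedAddCommGroup H]
    [NormedSpace ℝ H] [LocallyCompactSpace H] {a b : ℝ} {U : Set H} (hU : IsOpen U)
    {F : H → ℝ → ℝ} {F' : H → ℝ → H →L[ℝ] ℝ}
    (hF : ∀ x ∈ U, ContinuousOn (F x) (Set.uIcc a b))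
    (hF' : ContinuousOn (Function.uncurry F') (U ×ˢ Set.uIcc a b))
    (hd : ∀ x ∈ U, ∀ σ ∈ Set.uIcc a b, HasFDerivAt (fun y => F y σ) (F' x σ) x)
    {x : H} (hx : x ∈ U) :
    HasFDerivAt (fun y => ∫ σ in a..b, F y σ) (∫ σ in a..b, F' x σ) x := by
  obtain ⟨K, hK, hxK, hKU⟩ := exists_compact_subset hU hx
  obtain ⟨C, hC⟩ := (hK.prod (isCompact_uIcc (a := a) (b := b))).exists_bound_of_continuousOn
    (hF'.mono (Set.prod_mono hKU le_rfl))
  have hF'x : ContinuousOn (F' x) (Set.uIcc a b) :=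
    hF'.comp (by fun_prop : Continuous fun σ : ℝ => (x, σ)).continuousOn
      fun σ hσ => ⟨hx, hσ⟩
  refine intervalIntegral.hasFDerivAt_integral_of_dominated_of_fderiv_le (bound := fun _ => C)
    (mem_interior_iff_mem_nhds.1 hxK) ?_ (hF x hx).intervalIntegrable
    (hF'x.intervalIntegrable.aestronglyMeasurable_restrict_uIoc) ?_ (by simp) ?_
  · filter_upwards [hU.mem_nhds hx] with y hy
    exact (hF y hy).intervalIntegrable.aestronglyMeasurable_restrict_uIoc
  · exact Filter.Eventually.of_forall fun σ hσ y hy =>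
      hC (y, σ) ⟨hy, Set.uIoc_subset_uIcc hσ⟩
  · exact Filter.Eventually.of_forall fun σ hσ y hy =>
      hd y (hKU hy) σ (Set.uIoc_subset_uIcc hσ)

/-! ### The integrals `∫ σ^a (ρ + στ)^{-β} dσ` -/

/-- The integral `∫ σ in m..M, σ^a (ρ + στ)^{-β}` as a function of `p = (ρ, τ)`. -/
def powerIntegral (m M a β : ℝ) (p : ℝ × ℝ) : ℝ :=
  ∫ σ in m..M, σ ^ a * (p.1 + σ * p.2) ^ (-β)

/-- An open set of pairs `(ρ, τ)` on which `ρ + στ > 0` for all `σ` between `m` and `M`. -/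
def powerDomain (m M : ℝ) : Set (ℝ × ℝ) :=
  {p | 0 < p.2 ∧ 0 < p.1 + min m M * p.2}

theorem isOpen_powerDomain (m M : ℝ) : IsOpen (powerDomain m M) :=
  (isOpen_lt continuous_const continuous_snd).inter (isOpen_lt continuous_const
    (by fun_prop : Continuous fun p : ℝ × ℝ => p.1 + min m M * p.2))

theorem mem_powerDomain {m M ρ τ : ℝ} (hm : 0 < m) (hM : 0 < M) (hρ : 0 ≤ ρ) (hτ : 0 < τ) :
    (ρ, τ) ∈ powerDomain m M :=
  ⟨hτ, add_pos_of_nonneg_of_pos hρ (mul_pos (lt_min hm hM) hτ)⟩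

theorem pos_of_mem_powerDomain {m M : ℝ} {p : ℝ × ℝ} (hp : p ∈ powerDomain m M) {σ : ℝ}
    (hσ : σ ∈ Set.uIcc m M) : 0 < p.1 + σ * p.2 :=
  hp.2.trans_le (by have := mul_le_mul_of_nonneg_right hσ.1 hp.1.le; simpa using this)

theorem pos_of_mem_uIcc {m M σ : ℝ} (hm : 0 < m) (hM : 0 < M) (hσ : σ ∈ Set.uIcc m M) :
    0 < σ :=
  (lt_min hm hM).trans_le hσ.1

theorem continuousOn_powerIntegrand {m M : ℝ} (hm : 0 < m) (hM : 0 < M) (a β : ℝ) :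
    ContinuousOn (fun q : (ℝ × ℝ) × ℝ => q.2 ^ a * (q.1.1 + q.2 * q.1.2) ^ (-β))
      (powerDomain m M ×ˢ Set.uIcc m M) := by
  refine ContinuousOn.mul (ContinuousOn.rpow_const (by fun_prop) ?_)
    (ContinuousOn.rpow_const (by fun_prop) ?_)
  · exact fun q hq => Or.inl (pos_of_mem_uIcc hm hM hq.2).ne'
  · exact fun q hq => Or.inl (pos_of_mem_powerDomain hq.1 hq.2).ne'

theorem intervalIntegrable_powerIntegrand {m M : ℝ} (hm : 0 < m) (hM : 0 < M) (a β : ℝ)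
    {p : ℝ × ℝ} (hp : p ∈ powerDomain m M) :
    IntervalIntegrable (fun σ => σ ^ a * (p.1 + σ * p.2) ^ (-β)) volume m M :=
  ((continuousOn_powerIntegrand hm hM a β).comp
    (by fun_prop : Continuous fun σ : ℝ => (p, σ)).continuousOn
    fun _ hσ => ⟨hp, hσ⟩).intervalIntegrable

theorem hasFDerivAt_powerIntegral {m M : ℝ} (hm : 0 < m) (hM : 0 < M) (a β : ℝ)
    {p : ℝ × ℝ} (hp : p ∈ powerDomain m M) :
    HasFDerivAt (powerIntegral m M a β)
      ((-β * powerIntegral m M a (β + 1) p) • ContinuousLinearMap.fst ℝ ℝ ℝ +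
        (-β * powerIntegral m M (a + 1) (β + 1) p) • ContinuousLinearMap.snd ℝ ℝ ℝ) p := by
  have key := hasFDerivAt_intervalIntegral_of_continuousOn (a := m) (b := M)
    (isOpen_powerDomain m M)
    (F := fun p σ => σ ^ a * (p.1 + σ * p.2) ^ (-β))
    (F' := fun p σ =>
      (σ ^ a * (p.1 + σ * p.2) ^ (-(β + 1))) • ((-β) • ContinuousLinearMap.fst ℝ ℝ ℝ) +
      (σ ^ (a + 1) * (p.1 + σ * p.2) ^ (-(β + 1))) • ((-β) • ContinuousLinearMap.snd ℝ ℝ ℝ))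
    (fun x hx => (continuousOn_powerIntegrand hm hM a β).comp
      (by fun_prop : Continuous fun σ : ℝ => (x, σ)).continuousOn fun _ hσ => ⟨hx, hσ⟩)
    (((continuousOn_powerIntegrand hm hM a (β + 1)).smul continuousOn_const).add
      ((continuousOn_powerIntegrand hm hM (a + 1) (β + 1)).smul continuousOn_const))
    (fun x hx σ hσ => by
      have hσ0 := pos_of_mem_uIcc hm hM hσ
      have hlin : HasFDerivAt (fun y : ℝ × ℝ => y.1 + σ * y.2)
          (ContinuousLinearMap.fst ℝ ℝ ℝ + σ • ContinuousLinearMap.snd ℝ ℝ ℝ) x :=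
        hasFDerivAt_fst.add (hasFDerivAt_snd.const_mul σ)
      have h := ((hlin.rpow_const (p := -β)
        (Or.inl (pos_of_mem_powerDomain hx hσ).ne')).const_mul (σ ^ a))
      refine h.congr_fderiv ?_
      ext <;> simp [Real.rpow_add_one hσ0.ne', neg_add_eq_sub] <;> ring) hp
  refine key.congr_fderiv ?_
  rw [intervalIntegral.integral_add, intervalIntegral.integral_smul_const,
    intervalIntegral.integral_smul_const]
  · simp only [powerIntegral, smul_smul, mul_comm (-β)]
  · exact ((continuousOn_powerIntegrand hm hM a (β + 1)).comp
      (by fun_prop : Continuous fun σ : ℝ => (p, σ)).continuousOn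
      fun _ hσ => ⟨hp, hσ⟩).smul continuousOn_const |>.intervalIntegrable
  · exact ((continuousOn_powerIntegrand hm hM (a + 1) (β + 1)).comp
      (by fun_prop : Continuous fun σ : ℝ => (p, σ)).continuousOn
      fun _ hσ => ⟨hp, hσ⟩).smul continuousOn_const |>.intervalIntegrable

theorem contDiffOn_powerIntegral {m M : ℝ} (hm : 0 < m) (hM : 0 < M) (a β : ℝ) :
    ContDiffOn ℝ (⊤ : ℕ∞) (powerIntegral m M a β) (powerDomain m M) := by
  rw [contDiffOn_infty]
  intro n
  induction n generalizing a β with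
  | zero =>
    exact contDiffOn_zero.2 fun p hp =>
      (hasFDerivAt_powerIntegral hm hM a β hp).continuousAt.continuousWithinAt
  | succ n ih =>
    push_cast
    rw [contDiffOn_succ_iff_hasFDerivWithinAt_of_uniqueDiffOn
      (isOpen_powerDomain m M).uniqueDiffOn]
    refine ⟨by simp, _, ?_, fun p hp =>
      (hasFDerivAt_powerIntegral hm hM a β hp).hasFDerivWithinAt⟩
    exact ((contDiffOn_const.mul (ih _ _)).smul contDiffOn_const).add
      ((contDiffOn_const.mul (ih _ _)).smul contDiffOn_const)

theorem hasDerivAt_powerIntegral_fst {m M : ℝ} (hm : 0 < m) (hM : 0 < M) (a β : ℝ)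
    {ρ τ : ℝ} (hp : (ρ, τ) ∈ powerDomain m M) :
    HasDerivAt (fun r => powerIntegral m M a β (r, τ))
      (-β * powerIntegral m M a (β + 1) (ρ, τ)) ρ := by
  have h := (hasFDerivAt_powerIntegral hm hM a β hp).comp_hasDerivAt ρ
    ((hasDerivAt_id ρ).prodMk (hasDerivAt_const ρ τ))
  simpa [Function.comp_def] using h

theorem hasDerivAt_powerIntegral_snd {m M : ℝ} (hm : 0 < m) (hM : 0 < M) (a β : ℝ)
    {ρ τ : ℝ} (hp : (ρ, τ) ∈ powerDomain m M) :
    HasDerivAt (fun r => powerIntegral m M a β (ρ, r))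
      (-β * powerIntegral m M (a + 1) (β + 1) (ρ, τ)) τ := by
  have h := (hasFDerivAt_powerIntegral hm hM a β hp).comp_hasDerivAt τ
    ((hasDerivAt_const τ ρ).prodMk (hasDerivAt_id τ))
  simpa [Function.comp_def] using h

/-- Integration by parts, i.e. the integral of the `σ`-derivative of
`(M - σ) σ^{a+1} (ρ + στ)^{-(β+1)}`. -/
theorem powerIntegral_identity {m M : ℝ} (hm : 0 < m) (hM : 0 < M) (a β : ℝ)
    {ρ τ : ℝ} (hp : (ρ, τ) ∈ powerDomain m M) :
    (β + 1) * (τ * powerIntegral m M (a + 1 + 1) (β + 1 + 1) (ρ, τ) +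
        M * ρ * powerIntegral m M a (β + 1 + 1) (ρ, τ)) -
      (a + 2) * powerIntegral m M (a + 1) (β + 1) (ρ, τ) -
      M * (β - a) * powerIntegral m M a (β + 1) (ρ, τ) =
    -((M - m) * m ^ (a + 1) * (ρ + m * τ) ^ (-(β + 1))) := by
  have hI := fun a β => intervalIntegrable_powerIntegrand hm hM a β hp
  have hderiv : ∀ σ ∈ Set.uIcc m M,
      HasDerivAt (fun σ => (M - σ) * (σ ^ (a + 1) * (ρ + σ * τ) ^ (-(β + 1))))
        ((β + 1) * τ * (σ ^ (a + 1 + 1) * (ρ + σ * τ) ^ (-(β + 1 + 1))) +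
          (β + 1) * M * ρ * (σ ^ a * (ρ + σ * τ) ^ (-(β + 1 + 1))) -
          (a + 2) * (σ ^ (a + 1) * (ρ + σ * τ) ^ (-(β + 1))) -
          M * (β - a) * (σ ^ a * (ρ + σ * τ) ^ (-(β + 1)))) σ := by
    intro σ hσ
    have hσ0 := pos_of_mem_uIcc hm hM hσ
    have hA : 0 < ρ + σ * τ := pos_of_mem_powerDomain hp hσ
    have h1 := (hasDerivAt_id σ).rpow_const (p := a + 1) (Or.inl hσ0.ne')
    have h2 := (((hasDerivAt_id σ).mul_const τ).const_add ρ).rpow_const (p := -(β + 1))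
      (Or.inl hA.ne')
    refine (((hasDerivAt_id σ).const_sub M).mul (h1.mul h2)).congr_deriv ?_
    have e1 : (ρ + σ * τ) ^ (-(β + 1)) = (ρ + σ * τ) ^ (-(β + 1 + 1)) * (ρ + σ * τ) := by
      rw [← Real.rpow_add_one hA.ne']; ring_nf
    have e2 : -(β + 1) - 1 = -(β + 1 + 1) := by ring
    simp only [id, add_sub_cancel_right, e2, Pi.mul_apply]
    rw [Real.rpow_add_one hσ0.ne' (a + 1), Real.rpow_add_one hσ0.ne' a, e1]
    ring
  have hint := fun a β c => (hI a β).const_mul c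
  have h := intervalIntegral.integral_eq_sub_of_hasDerivAt hderiv
    ((((hint _ _ _).add (hint _ _ _)).sub (hint _ _ _)).sub (hint _ _ _))
  rw [intervalIntegral.integral_sub (((hint _ _ _).add (hint _ _ _)).sub (hint _ _ _))
      (hint _ _ _),
    intervalIntegral.integral_sub ((hint _ _ _).add (hint _ _ _)) (hint _ _ _),
    intervalIntegral.integral_add (hint _ _ _) (hint _ _ _)] at h
  simp only [intervalIntegral.integral_const_mul] at h
  simp only [powerIntegral]
  linear_combination h

/-! ### The Bessel operator in the extension variable -/

theorem bessel_rpow_mul_comp_sq {s t f₁ f₂ : ℝ} {f g : ℝ → ℝ} (ht : 0 < t)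
    (hf : ∀ τ, 0 < τ → HasDerivAt f (g τ) τ) (hf₁ : g (t ^ 2) = f₁)
    (hg : HasDerivAt g f₂ (t ^ 2)) :
    deriv (fun τ => deriv (fun τ' => τ' ^ (2 * s) * f (τ' ^ 2)) τ) t +
        ((1 - 2 * s) / t) * deriv (fun τ => τ ^ (2 * s) * f (τ ^ 2)) t =
      t ^ (2 * s) * (4 * t ^ 2 * f₂ + (4 + 4 * s) * f₁) := by
  have hsq : ∀ τ : ℝ, HasDerivAt (fun τ : ℝ => τ ^ 2) (2 * τ) τ := fun τ => by
    simpa using hasDerivAt_pow 2 τ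
  have hpow : ∀ p τ : ℝ, 0 < τ → HasDerivAt (fun τ : ℝ => τ ^ p) (p * τ ^ (p - 1)) τ :=
    fun p τ hτ => by simpa using Real.hasDerivAt_rpow_const (p := p) (Or.inl hτ.ne')
  have h1 : ∀ τ, 0 < τ → HasDerivAt (fun τ => τ ^ (2 * s) * f (τ ^ 2))
      (2 * s * τ ^ (2 * s - 1) * f (τ ^ 2) + τ ^ (2 * s) * (g (τ ^ 2) * (2 * τ))) τ :=
    fun τ hτ => (hpow _ τ hτ).mul ((hf _ (by positivity)).comp τ (hsq τ))
  have h2 : HasDerivAt (fun τ =>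
      2 * s * τ ^ (2 * s - 1) * f (τ ^ 2) + τ ^ (2 * s) * (g (τ ^ 2) * (2 * τ)))
      ((2 * s * ((2 * s - 1) * t ^ (2 * s - 1 - 1)) * f (t ^ 2) +
        2 * s * t ^ (2 * s - 1) * (g (t ^ 2) * (2 * t))) +
        (2 * s * t ^ (2 * s - 1) * (g (t ^ 2) * (2 * t)) +
        t ^ (2 * s) * (f₂ * (2 * t) * (2 * t) + g (t ^ 2) * 2))) t := by
    refine (((hpow _ t ht).const_mul (2 * s)).mul
      ((hf _ (by positivity)).comp t (hsq t))).add
      ((hpow _ t ht).mul ((HasDerivAt.comp t (h₂ := g) (h := fun τ => τ ^ 2) hg (hsq t)).mul ?_))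
    simpa using (hasDerivAt_id t).const_mul 2
  have heq : (fun τ => deriv (fun τ' => τ' ^ (2 * s) * f (τ' ^ 2)) τ) =ᶠ[nhds t] fun τ =>
      2 * s * τ ^ (2 * s - 1) * f (τ ^ 2) + τ ^ (2 * s) * (g (τ ^ 2) * (2 * τ)) := by
    filter_upwards [lt_mem_nhds ht] with τ hτ using (h1 τ hτ).deriv
  rw [heq.deriv_eq, h2.deriv, (h1 t ht).deriv, hf₁, Real.rpow_sub_one ht.ne',
    Real.rpow_sub_one ht.ne']
  field_simp
  ring

/-! ### The Lamé operator in the space variables -/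

section Spatial

variable {d : ℕ} {k : Fin d} {f g : EuclideanSpace ℝ (Fin d) → ℝ} {f' g' : ℝ}
  {x : EuclideanSpace ℝ (Fin d)}

/-- `f` is differentiable at `x` with `k`-th partial derivative `f'`. -/
def HasPDerAt (k : Fin d) (f : EuclideanSpace ℝ (Fin d) → ℝ) (f' : ℝ)
    (x : EuclideanSpace ℝ (Fin d)) : Prop :=
  DifferentiableAt ℝ f x ∧ pder d k f x = f'

namespace HasPDerAt

theorem add (hf : HasPDerAt k f f' x) (hg : HasPDerAt k g g' x) :
    HasPDerAt k (fun y => f y + g y) (f' + g') x :=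
  ⟨hf.1.fun_add hg.1, by rw [← hf.2, ← hg.2]; simp [pder, fderiv_fun_add hf.1 hg.1]⟩

theorem mul (hf : HasPDerAt k f f' x) (hg : HasPDerAt k g g' x) :
    HasPDerAt k (fun y => f y * g y) (f' * g x + f x * g') x :=
  ⟨hf.1.fun_mul hg.1, by
    rw [← hf.2, ← hg.2]; simp [pder, fderiv_fun_mul hf.1 hg.1]; ring⟩

theorem const (c : ℝ) : HasPDerAt k (fun _ => c) 0 x :=
  ⟨differentiableAt_const c, by simp [pder]⟩

theorem coord (i : Fin d) : HasPDerAt k (fun y => y i) (if i = k then 1 else 0) x := by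
  have h : HasFDerivAt (fun y : EuclideanSpace ℝ (Fin d) => y i)
      (EuclideanSpace.proj i : EuclideanSpace ℝ (Fin d) →L[ℝ] ℝ) x :=
    (EuclideanSpace.proj i : EuclideanSpace ℝ (Fin d) →L[ℝ] ℝ).hasFDerivAt
  exact ⟨h.differentiableAt, by simp [pder, h.fderiv]⟩

theorem comp_norm_sq {F : ℝ → ℝ} {F' : ℝ} (hF : HasDerivAt F F' (‖x‖ ^ 2)) :
    HasPDerAt k (fun y => F (‖y‖ ^ 2)) (2 * x k * F') x := by
  have h : HasFDerivAt (fun y => F (‖y‖ ^ 2)) (F' • (2 • innerSL ℝ x)) x :=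
    hF.comp_hasFDerivAt x (hasStrictFDerivAt_norm_sq x).hasFDerivAt
  refine ⟨h.differentiableAt, ?_⟩
  simp [pder, h.fderiv, EuclideanSpace.inner_single_right]
  ring

end HasPDerAt

variable {p p₁ p₂ q q₁ q₂ : ℝ → ℝ}

theorem pder_radial_tensor (hp : ∀ r, 0 ≤ r → HasDerivAt p (p₁ r) r)
    (hq : ∀ r, 0 ≤ r → HasDerivAt q (q₁ r) r) (k : Fin d) (δ : ℝ) (i j : Fin d)
    (x : EuclideanSpace ℝ (Fin d)) :
    pder d k (fun y => δ * p (‖y‖ ^ 2) + 2 * q (‖y‖ ^ 2) * (y i * y j)) x =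
      δ * (2 * x k * p₁ (‖x‖ ^ 2)) + 2 * (2 * x k * q₁ (‖x‖ ^ 2)) * (x i * x j) +
        2 * q (‖x‖ ^ 2) * ((if i = k then 1 else 0) * x j + x i * (if j = k then 1 else 0)) := by
  have hx := sq_nonneg ‖x‖
  refine (((HasPDerAt.const δ).mul (.comp_norm_sq (hp _ hx))).add
    (((HasPDerAt.const 2).mul (.comp_norm_sq (hq _ hx))).mul
      ((HasPDerAt.coord i).mul (.coord j)))).2.trans ?_
  ring

theorem laplacian_radial_tensor (hp : ∀ r, 0 ≤ r → HasDerivAt p (p₁ r) r)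
    (hp₁ : ∀ r, 0 ≤ r → HasDerivAt p₁ (p₂ r) r) (hq : ∀ r, 0 ≤ r → HasDerivAt q (q₁ r) r)
    (hq₁ : ∀ r, 0 ≤ r → HasDerivAt q₁ (q₂ r) r) (i j : Fin d)
    (x : EuclideanSpace ℝ (Fin d)) :
    ∑ k, pder d k (fun y => pder d k (fun z => (if i = j then 1 else 0) * p (‖z‖ ^ 2) +
        2 * q (‖z‖ ^ 2) * (z i * z j)) y) x =
      (if i = j then 1 else 0) * (2 * d * p₁ (‖x‖ ^ 2) + 4 * ‖x‖ ^ 2 * p₂ (‖x‖ ^ 2) +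
        4 * q (‖x‖ ^ 2)) +
      2 * (x i * x j) * ((2 * d + 8) * q₁ (‖x‖ ^ 2) + 4 * ‖x‖ ^ 2 * q₂ (‖x‖ ^ 2)) := by
  have hx := sq_nonneg ‖x‖
  have hterm : ∀ k : Fin d,
      pder d k (fun y => pder d k (fun z => (if i = j then 1 else 0) * p (‖z‖ ^ 2) +
        2 * q (‖z‖ ^ 2) * (z i * z j)) y) x =
      (if i = j then 1 else 0) * (2 * p₁ (‖x‖ ^ 2)) +
      (if i = j then 1 else 0) * (4 * p₂ (‖x‖ ^ 2)) * x k ^ 2 +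
      8 * q₂ (‖x‖ ^ 2) * (x i * x j) * x k ^ 2 + 4 * q₁ (‖x‖ ^ 2) * (x i * x j) +
      8 * q₁ (‖x‖ ^ 2) * x j * ((if i = k then 1 else 0) * x k) +
      8 * q₁ (‖x‖ ^ 2) * x i * ((if j = k then 1 else 0) * x k) +
      4 * q (‖x‖ ^ 2) * ((if i = k then 1 else 0) * (if j = k then 1 else 0)) := by
    intro k
    simp only [pder_radial_tensor hp hq]
    refine ((((HasPDerAt.const _).mul
        (((HasPDerAt.const 2).mul (.coord k)).mul (.comp_norm_sq (hp₁ _ hx)))).add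
      (((HasPDerAt.const 2).mul (((HasPDerAt.const 2).mul (.coord k)).mul
        (.comp_norm_sq (hq₁ _ hx)))).mul ((HasPDerAt.coord i).mul (.coord j)))).add
      (((HasPDerAt.const 2).mul (.comp_norm_sq (hq _ hx))).mul
        (((HasPDerAt.const _).mul (.coord j)).add
          ((HasPDerAt.coord i).mul (.const _))))).2.trans ?_
    simp only [if_true]
    ring
  simp only [hterm, Finset.sum_add_distrib, ← Finset.mul_sum, ← EuclideanSpace.real_norm_sq_eq]
  simp only [ite_mul, one_mul, zero_mul, Finset.sum_ite_eq, Finset.mem_univ, if_true,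
    Finset.sum_const, Finset.card_univ, Fintype.card_fin, nsmul_eq_mul, eq_comm (a := j) (b := i)]
  split_ifs <;> ring

theorem grad_div_radial_tensor (hp : ∀ r, 0 ≤ r → HasDerivAt p (p₁ r) r)
    (hp₁ : ∀ r, 0 ≤ r → HasDerivAt p₁ (p₂ r) r) (hq : ∀ r, 0 ≤ r → HasDerivAt q (q₁ r) r)
    (hq₁ : ∀ r, 0 ≤ r → HasDerivAt q₁ (q₂ r) r) (i j : Fin d)
    (x : EuclideanSpace ℝ (Fin d)) :
    pder d i (fun y => ∑ k, pder d k (fun z => (if k = j then 1 else 0) * p (‖z‖ ^ 2) +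
        2 * q (‖z‖ ^ 2) * (z k * z j)) y) x =
      (if i = j then 1 else 0) * (2 * p₁ (‖x‖ ^ 2) + 4 * ‖x‖ ^ 2 * q₁ (‖x‖ ^ 2) +
        2 * (d + 1) * q (‖x‖ ^ 2)) +
      2 * (x i * x j) * (2 * p₂ (‖x‖ ^ 2) + 4 * q₁ (‖x‖ ^ 2) + 4 * ‖x‖ ^ 2 * q₂ (‖x‖ ^ 2) +
        2 * (d + 1) * q₁ (‖x‖ ^ 2)) := by
  have hdiv : ∀ y : EuclideanSpace ℝ (Fin d),
      ∑ k, pder d k (fun z => (if k = j then 1 else 0) * p (‖z‖ ^ 2) +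
        2 * q (‖z‖ ^ 2) * (z k * z j)) y =
      y j * (2 * p₁ (‖y‖ ^ 2) + 4 * ‖y‖ ^ 2 * q₁ (‖y‖ ^ 2) + 2 * (d + 1) * q (‖y‖ ^ 2)) := by
    intro y
    have hterm : ∀ k : Fin d, pder d k (fun z => (if k = j then 1 else 0) * p (‖z‖ ^ 2) +
        2 * q (‖z‖ ^ 2) * (z k * z j)) y =
        (2 * p₁ (‖y‖ ^ 2) + 2 * q (‖y‖ ^ 2)) * ((if j = k then 1 else 0) * y k) +
        4 * q₁ (‖y‖ ^ 2) * y j * y k ^ 2 + 2 * q (‖y‖ ^ 2) * y j := by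
      intro k
      rw [pder_radial_tensor hp hq, if_pos (rfl : k = k)]
      simp only [eq_comm (a := k) (b := j)]
      ring
    simp only [hterm, Finset.sum_add_distrib, ← Finset.mul_sum,
      ← EuclideanSpace.real_norm_sq_eq]
    simp only [ite_mul, one_mul, zero_mul, Finset.sum_ite_eq, Finset.mem_univ, if_true,
      Finset.sum_const, Finset.card_univ, Fintype.card_fin, nsmul_eq_mul]
    ring
  simp only [hdiv]
  have hx := sq_nonneg ‖x‖
  have hF : HasDerivAt (fun r => 2 * p₁ r + 4 * r * q₁ r + 2 * (d + 1) * q r)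
      (2 * p₂ (‖x‖ ^ 2) + (4 * 1 * q₁ (‖x‖ ^ 2) + 4 * ‖x‖ ^ 2 * q₂ (‖x‖ ^ 2)) +
        2 * (d + 1) * q₁ (‖x‖ ^ 2)) (‖x‖ ^ 2) :=
    (((hp₁ _ hx).const_mul 2).add (((hasDerivAt_id _).const_mul 4).mul (hq₁ _ hx))).add
      ((hq _ hx).const_mul _)
  refine ((HasPDerAt.coord j).mul (.comp_norm_sq hF)).2.trans ?_
  simp only [eq_comm (a := j) (b := i)]
  ring

end Spatial

/-! ### The Poisson kernel as a radial tensor -/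

theorem hasDerivAt_add_const_rpow_neg {r b : ℝ} (h : 0 < r + b) (β : ℝ) :
    HasDerivAt (fun r => (r + b) ^ (-β)) (-β * (r + b) ^ (-(β + 1))) r := by
  refine (((hasDerivAt_id r).add_const b).rpow_const (p := -β) (Or.inl h.ne')).congr_deriv ?_
  simp only [id, neg_add']
  ring

theorem hasDerivAt_const_add_mul_rpow_neg {r b m : ℝ} (h : 0 < b + m * r) (β : ℝ) :
    HasDerivAt (fun r => (b + m * r) ^ (-β)) (-β * m * (b + m * r) ^ (-(β + 1))) r := by
  refine ((((hasDerivAt_id r).const_mul m).const_add b).rpow_const (p := -β)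
    (Or.inl h.ne')).congr_deriv ?_
  simp only [id, neg_add']
  ring

/-- The coefficient of the identity matrix in the kernel, up to the factor `t^{2s}`, as a function
of `(‖x‖², t²)`. -/
def isotropicPart (c s m M ν : ℝ) (p : ℝ × ℝ) : ℝ :=
  c * (2 * m ^ s * (p.1 + m * p.2) ^ (-ν) - powerIntegral m M (s - 1) ν p)

/-- The coefficient of `2 x ⊗ x` in the kernel, up to the factor `t^{2s}`, as a function of
`(‖x‖², t²)`. -/
def tensorPart (c s m M ν : ℝ) (p : ℝ × ℝ) : ℝ :=
  c * (ν * powerIntegral m M (s - 1) (ν + 1) p)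

theorem integral_div_rpow_eq_powerIntegral {m M a β ρ τ : ℝ} (hp : (ρ, τ) ∈ powerDomain m M) :
    ∫ σ in m..M, σ ^ a / (ρ + σ * τ) ^ β = powerIntegral m M a β (ρ, τ) :=
  intervalIntegral.integral_congr fun σ hσ => by
    simp [Real.rpow_neg (pos_of_mem_powerDomain hp hσ).le, div_eq_mul_inv]

theorem lamePoissonEntry_eq {d : ℕ} {s μ lam : ℝ} (hμ : 0 < μ) (hlam : 0 < 2 * μ + lam)
    (x : EuclideanSpace ℝ (Fin d)) {t : ℝ} (ht : 0 < t) (i j : Fin d) {c ν : ℝ}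
    (hc : c = Real.Gamma ((d : ℝ) / 2 + s) / (2 * π ^ ((d : ℝ) / 2) * Real.Gamma s))
    (hν : ν = (d : ℝ) / 2 + s) :
    lamePoissonEntry d s μ lam x t i j =
      t ^ (2 * s) * ((if i = j then 1 else 0) *
        isotropicPart c s μ (2 * μ + lam) ν (‖x‖ ^ 2, t ^ 2) +
        2 * tensorPart c s μ (2 * μ + lam) ν (‖x‖ ^ 2, t ^ 2) * (x i * x j)) := by
  have hp := mem_powerDomain hμ hlam (sq_nonneg ‖x‖) (pow_pos ht 2)
  have hA : 0 < ‖x‖ ^ 2 + μ * t ^ 2 := by positivity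
  have e1 : ((d : ℝ) + 2 * s) / 2 = ν := by rw [hν]; ring
  have e2 : ((d : ℝ) + 2 * s + 2) / 2 = ν + 1 := by rw [hν]; ring
  have e3 : (d : ℝ) + 2 * s = 2 * ν := by rw [hν]; ring
  have e4 : Real.Gamma ((d : ℝ) / 2 + s) / (π ^ ((d : ℝ) / 2) * Real.Gamma s) = 2 * c := by
    rw [hc, mul_assoc, ← div_div, ← mul_div_assoc]
    ring
  rw [lamePoissonEntry, e1, e2, e3, e4, ← hc, integral_div_rpow_eq_powerIntegral hp,
    integral_div_rpow_eq_powerIntegral hp, isotropicPart, tensorPart, Real.rpow_neg hA.le]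
  ring

theorem contDiffOn_lamePoissonEntry {d : ℕ} {s μ lam : ℝ} (hμ : 0 < μ)
    (hlam : 0 < 2 * μ + lam) (i j : Fin d) :
    ContDiffOn ℝ (⊤ : ℕ∞)
      (fun p : EuclideanSpace ℝ (Fin d) × ℝ => lamePoissonEntry d s μ lam p.1 p.2 i j)
      {p : EuclideanSpace ℝ (Fin d) × ℝ | 0 < p.2} := by
  have hpair : ContDiff ℝ (⊤ : ℕ∞)
      fun p : EuclideanSpace ℝ (Fin d) × ℝ => (‖p.1‖ ^ 2, p.2 ^ 2) :=
    (contDiff_fst.norm_sq ℝ).prodMk (contDiff_snd.pow 2)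
  have hcoord : ∀ k : Fin d, ContDiff ℝ (⊤ : ℕ∞)
      fun p : EuclideanSpace ℝ (Fin d) × ℝ => p.1 k := fun k =>
    (EuclideanSpace.proj k : EuclideanSpace ℝ (Fin d) →L[ℝ] ℝ).contDiff.comp contDiff_fst
  have hint : ∀ a β, ContDiffOn ℝ (⊤ : ℕ∞) (fun p : EuclideanSpace ℝ (Fin d) × ℝ =>
      powerIntegral μ (2 * μ + lam) a β (‖p.1‖ ^ 2, p.2 ^ 2)) {p | 0 < p.2} := fun a β =>
    (contDiffOn_powerIntegral hμ hlam a β).comp hpair.contDiffOn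
      fun p hp => mem_powerDomain hμ hlam (sq_nonneg _) (pow_pos hp 2)
  have hiso : ContDiffOn ℝ (⊤ : ℕ∞) (fun p : EuclideanSpace ℝ (Fin d) × ℝ =>
      (‖p.1‖ ^ 2 + μ * p.2 ^ 2) ^ (-((d : ℝ) / 2 + s))) {p | 0 < p.2} :=
    ContDiffOn.rpow_const_of_ne
      ((contDiff_fst.norm_sq ℝ).add (contDiff_const.mul (contDiff_snd.pow 2))).contDiffOn
      fun p (hp : 0 < p.2) => by positivity
  have hpow : ContDiffOn ℝ (⊤ : ℕ∞) (fun p : EuclideanSpace ℝ (Fin d) × ℝ =>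
      p.2 ^ (2 * s)) {p | 0 < p.2} :=
    ContDiffOn.rpow_const_of_ne contDiff_snd.contDiffOn fun p (hp : 0 < p.2) => hp.ne'
  refine ContDiffOn.congr ?_ fun p hp => lamePoissonEntry_eq hμ hlam p.1 hp i j rfl rfl
  exact hpow.mul ((contDiffOn_const.mul
      (contDiffOn_const.mul ((contDiffOn_const.mul hiso).sub (hint _ _)))).add
    ((contDiffOn_const.mul (contDiffOn_const.mul (contDiffOn_const.mul (hint _ _)))).mul
      ((hcoord i).mul (hcoord j)).contDiffOn))

/-- The Poisson kernel is smooth on `ℝ^d × (0,∞)` and each of its columns solves the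
degenerate elliptic extension system
`∂_{tt}U + ((1−2s)/t)∂_t U + μΔ_x U + (μ+λ)∇_x div_x U = 0`. -/
theorem lamePoisson_solves_extension (d : ℕ) (hd : 2 ≤ d) (s : ℝ)
    (hs : s ∈ Set.Ioo (0 : ℝ) 1) (μ lam : ℝ) (hμ : 0 < μ) (hlam : 0 < 2 * μ + lam) :
    (∀ i j : Fin d,
      ContDiffOn ℝ (⊤ : ℕ∞)
        (fun p : EuclideanSpace ℝ (Fin d) × ℝ => lamePoissonEntry d s μ lam p.1 p.2 i j)
        {p : EuclideanSpace ℝ (Fin d) × ℝ | 0 < p.2}) ∧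
    ∀ (x : EuclideanSpace ℝ (Fin d)) (t : ℝ), 0 < t → ∀ i j : Fin d,
      deriv (fun τ => deriv (fun τ' => lamePoissonEntry d s μ lam x τ' i j) τ) t +
          ((1 - 2 * s) / t) * deriv (fun τ => lamePoissonEntry d s μ lam x τ i j) t +
          μ * (∑ k : Fin d,
            pder d k (fun y => pder d k (fun z => lamePoissonEntry d s μ lam z t i j) y) x) +
          (μ + lam) *
            pder d i
              (fun y => ∑ k : Fin d,
                pder d k (fun z => lamePoissonEntry d s μ lam z t k j) y) x = 0 := by
  refine ⟨contDiffOn_lamePoissonEntry hμ hlam, fun x t ht i j => ?_⟩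
  have hτ : 0 < t ^ 2 := pow_pos ht 2
  obtain ⟨c, hc⟩ : ∃ c, c = Real.Gamma ((d : ℝ) / 2 + s) /
    (2 * π ^ ((d : ℝ) / 2) * Real.Gamma s) := ⟨_, rfl⟩
  obtain ⟨ν, hν⟩ : ∃ ν, ν = (d : ℝ) / 2 + s := ⟨_, rfl⟩
  have hd' : (d : ℝ) = 2 * ν - 2 * s := by rw [hν]; ring
  have hentry := fun (y : EuclideanSpace ℝ (Fin d)) {τ : ℝ} (hτ : 0 < τ) (k l : Fin d) =>
    lamePoissonEntry_eq hμ hlam y hτ k l hc hν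
  have hdom := fun {r τ : ℝ} (hr : 0 ≤ r) (hτ : 0 < τ) => mem_powerDomain hμ hlam hr hτ
  have hA : ∀ {r τ : ℝ}, 0 ≤ r → 0 < τ → 0 < r + μ * τ := fun hr hτ => by positivity
  have hspace : ∀ (y : EuclideanSpace ℝ (Fin d)) (k l : Fin d),
      lamePoissonEntry d s μ lam y t k l = (if k = l then 1 else 0) *
        (t ^ (2 * s) * isotropicPart c s μ (2 * μ + lam) ν (‖y‖ ^ 2, t ^ 2)) +
        2 * (t ^ (2 * s) * tensorPart c s μ (2 * μ + lam) ν (‖y‖ ^ 2, t ^ 2)) * (y k * y l) :=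
    fun y k l => by rw [hentry y ht]; ring
  have hp : ∀ r, 0 ≤ r →
      HasDerivAt (fun r => t ^ (2 * s) * isotropicPart c s μ (2 * μ + lam) ν (r, t ^ 2)) _ r :=
    fun r hr => ((((hasDerivAt_add_const_rpow_neg (hA hr hτ) ν).const_mul (2 * μ ^ s)).sub
      (hasDerivAt_powerIntegral_fst hμ hlam (s - 1) ν (hdom hr hτ))).const_mul c).const_mul
        (t ^ (2 * s))
  have hp₁ : ∀ r, 0 ≤ r → HasDerivAt (fun r => t ^ (2 * s) * (c * (2 * μ ^ s *
      (-ν * (r + μ * t ^ 2) ^ (-(ν + 1))) -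
        -ν * powerIntegral μ (2 * μ + lam) (s - 1) (ν + 1) (r, t ^ 2)))) _ r := fun r hr =>
    (((((hasDerivAt_add_const_rpow_neg (hA hr hτ) (ν + 1)).const_mul
      (-ν)).const_mul (2 * μ ^ s)).sub
      ((hasDerivAt_powerIntegral_fst hμ hlam (s - 1) (ν + 1) (hdom hr hτ)).const_mul
        (-ν))).const_mul c).const_mul (t ^ (2 * s))
  have hq : ∀ r, 0 ≤ r →
      HasDerivAt (fun r => t ^ (2 * s) * tensorPart c s μ (2 * μ + lam) ν (r, t ^ 2)) _ r :=
    fun r hr => (((hasDerivAt_powerIntegral_fst hμ hlam (s - 1) (ν + 1)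
      (hdom hr hτ)).const_mul ν).const_mul c).const_mul (t ^ (2 * s))
  have hq₁ : ∀ r, 0 ≤ r → HasDerivAt (fun r => t ^ (2 * s) * (c * (ν * (-(ν + 1) *
      powerIntegral μ (2 * μ + lam) (s - 1) (ν + 1 + 1) (r, t ^ 2))))) _ r := fun r hr =>
    ((((hasDerivAt_powerIntegral_fst hμ hlam (s - 1) (ν + 1 + 1)
      (hdom hr hτ)).const_mul (-(ν + 1))).const_mul ν).const_mul c).const_mul (t ^ (2 * s))
  have hx := sq_nonneg ‖x‖
  have hf : ∀ τ, 0 < τ → HasDerivAt (fun τ => (if i = j then 1 else 0) *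
        isotropicPart c s μ (2 * μ + lam) ν (‖x‖ ^ 2, τ) +
        2 * tensorPart c s μ (2 * μ + lam) ν (‖x‖ ^ 2, τ) * (x i * x j)) _ τ := fun τ hτ =>
    (((((hasDerivAt_const_add_mul_rpow_neg (hA hx hτ) ν).const_mul (2 * μ ^ s)).sub
      (hasDerivAt_powerIntegral_snd hμ hlam (s - 1) ν (hdom hx hτ))).const_mul c).const_mul
        (if i = j then 1 else 0)).add
    (((((hasDerivAt_powerIntegral_snd hμ hlam (s - 1) (ν + 1)
      (hdom hx hτ)).const_mul ν).const_mul c).const_mul 2).mul_const (x i * x j))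
  have hf₁ : HasDerivAt (fun τ => (if i = j then 1 else 0) * (c * (2 * μ ^ s *
      (-ν * μ * (‖x‖ ^ 2 + μ * τ) ^ (-(ν + 1))) -
        -ν * powerIntegral μ (2 * μ + lam) (s - 1 + 1) (ν + 1) (‖x‖ ^ 2, τ))) +
      2 * (c * (ν * (-(ν + 1) * powerIntegral μ (2 * μ + lam) (s - 1 + 1) (ν + 1 + 1)
        (‖x‖ ^ 2, τ)))) * (x i * x j)) _ (t ^ 2) :=
    ((((((hasDerivAt_const_add_mul_rpow_neg (hA hx hτ) (ν + 1)).const_mul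
      (-ν * μ)).const_mul (2 * μ ^ s)).sub
      ((hasDerivAt_powerIntegral_snd hμ hlam (s - 1 + 1) (ν + 1) (hdom hx hτ)).const_mul
        (-ν))).const_mul c).const_mul (if i = j then 1 else 0)).add
    ((((((hasDerivAt_powerIntegral_snd hμ hlam (s - 1 + 1) (ν + 1 + 1)
      (hdom hx hτ)).const_mul (-(ν + 1))).const_mul ν).const_mul c).const_mul 2).mul_const
        (x i * x j))
  have htime : (fun τ => lamePoissonEntry d s μ lam x τ i j) =ᶠ[nhds t] fun τ =>
      τ ^ (2 * s) * ((if i = j then 1 else 0) *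
        isotropicPart c s μ (2 * μ + lam) ν (‖x‖ ^ 2, τ ^ 2) +
        2 * tensorPart c s μ (2 * μ + lam) ν (‖x‖ ^ 2, τ ^ 2) * (x i * x j)) := by
    filter_upwards [lt_mem_nhds ht] with τ hτ using hentry x hτ i j
  have hB := bessel_rpow_mul_comp_sq (s := s) ht hf rfl hf₁
  rw [htime.deriv.deriv_eq, htime.deriv_eq, hB]
  simp only [hspace]
  rw [laplacian_radial_tensor hp hp₁ hq hq₁, grad_div_radial_tensor hp hp₁ hq hq₁]
  have key₁ := powerIntegral_identity hμ hlam (s - 1) ν (hdom hx hτ)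
  have key₂ := powerIntegral_identity hμ hlam (s - 1) (ν + 1) (hdom hx hτ)
  have hμs : μ ^ (s - 1 + 1) = μ ^ s := by rw [sub_add_cancel]
  have hA₂ : (‖x‖ ^ 2 + μ * t ^ 2) ^ (-(ν + 1)) =
      (‖x‖ ^ 2 + μ * t ^ 2) ^ (-(ν + 1 + 1)) * (‖x‖ ^ 2 + μ * t ^ 2) := by
    rw [← Real.rpow_add_one (hA hx hτ).ne']; ring_nf
  rw [hμs] at key₁ key₂
  simp only [tensorPart, hd']
  generalize (if i = j then (1 : ℝ) else 0) = δ
  linear_combination t ^ (2 * s) * c * (-δ * (8 * μ * ν * (ν + 1) * μ ^ s) * hA₂ -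
    4 * ν * δ * key₁ + 8 * ν * (ν + 1) * (x i * x j) * key₂)
end
end
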